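/- Let f be a complex polynomial of degree d ≥ 2. If no critical point of f belongs to the filled-in Julia set K_f (i.e. every zero of f′ has unbounded forward orbit under f), then the Julia set J_f is a Cantor set, i.e. nonempty, compact, perfect and totally disconnected. -/

import Mathlib

section

open Set Filter Topology Metric Polynomial

/-- `HasWinding T φ n`: along `[0, T]` a continuous logarithm of `φ` increases by `2 * π * i * n`. -/
def HasWinding (T : ℝ) (φ : ℝ → ℂ) (n : ℤ) : Prop :=
  ∃ L : ℝ → ℂ, Continuous L ∧ (∀ t, Complex.exp (L t) = φ t) ∧
    L T - L 0 = n * (2 * Real.pi * Complex.I)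

namespace HasWinding

variable {T : ℝ} {φ ψ : ℝ → ℂ} {m n : ℤ}

theorem mul (h₁ : HasWinding T φ m) (h₂ : HasWinding T ψ n) :
    HasWinding T (fun t => φ t * ψ t) (m + n) := by
  obtain ⟨L, hL, hLe, hLd⟩ := h₁
  obtain ⟨M, hM, hMe, hMd⟩ := h₂
  refine ⟨fun t => L t + M t, hL.add hM, fun t => by rw [Complex.exp_add, hLe, hMe], ?_⟩
  push_cast
  linear_combination hLd + hMd

theorem inv (h : HasWinding T φ m) : HasWinding T (fun t => (φ t)⁻¹) (-m) := by
  obtain ⟨L, hL, hLe, hLd⟩ := h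
  refine ⟨fun t => -L t, hL.neg, fun t => by rw [Complex.exp_neg, hLe], ?_⟩
  push_cast
  linear_combination -hLd

theorem const {c : ℂ} (hc : c ≠ 0) : HasWinding T (fun _ => c) 0 :=
  ⟨fun _ => Complex.log c, continuous_const, fun _ => Complex.exp_log hc, by simp⟩

theorem of_mem_slitPlane (hφ : Continuous φ) (hs : ∀ t, φ t ∈ Complex.slitPlane)
    (hT : φ T = φ 0) : HasWinding T φ 0 :=
  ⟨fun t => Complex.log (φ t), hφ.clog hs,
    fun t => Complex.exp_log (Complex.slitPlane_ne_zero (hs t)),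
    by simp [hT]⟩

theorem ne_zero (h : HasWinding T φ m) (t : ℝ) : φ t ≠ 0 := by
  obtain ⟨L, -, hLe, -⟩ := h
  rw [← hLe]
  exact Complex.exp_ne_zero _

theorem apply_eq (h : HasWinding T φ m) : φ T = φ 0 := by
  obtain ⟨L, -, hLe, hLd⟩ := h
  rw [← hLe, ← hLe, Complex.exp_eq_exp_iff_exists_int]
  exact ⟨m, by linear_combination hLd⟩

theorem eq_zero_of_one (h : HasWinding T (fun _ => 1) n) : n = 0 := by
  obtain ⟨L, hL, hLe, hLd⟩ := h
  obtain ⟨M, ⟨-, -⟩, hM⟩ := Complex.isCoveringMapOn_exp.existsUnique_continuousMap_lifts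
    (ContinuousMap.const ℝ (1 : ℂ)) (a₀ := 0) (e₀ := L 0) (by simpa using hLe 0) (by simp)
  have h1 := hM ⟨L, hL⟩ ⟨rfl, by ext t; simp [hLe]⟩
  have h2 := hM (ContinuousMap.const ℝ (L 0)) ⟨rfl, by ext t; simp [hLe]⟩
  have h3 : L T = L 0 := by
    have := congrArg (fun F : C(ℝ, ℂ) => F T) (h1.trans h2.symm)
    simpa using this
  rw [h3, sub_self] at hLd
  have := Complex.two_pi_I_ne_zero
  have h4 : (n : ℂ) = 0 := by
    rcases mul_eq_zero.1 hLd.symm with h | h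
    · exact h
    · exact absurd h this
  exact_mod_cast h4

theorem unique (h₁ : HasWinding T φ m) (h₂ : HasWinding T φ n) : m = n := by
  have h := h₁.mul h₂.inv
  have : (fun t => φ t * (φ t)⁻¹) = fun _ => 1 := by
    ext t
    exact mul_inv_cancel₀ (h₁.ne_zero t)
  rw [this] at h
  have := h.eq_zero_of_one
  lia

theorem exists_of_ne_zero (hφ : Continuous φ) (h0 : ∀ t, φ t ≠ 0) (hT : φ T = φ 0) :
    ∃ n, HasWinding T φ n := by
  obtain ⟨L, ⟨-, hL⟩, -⟩ := Complex.isCoveringMapOn_exp.existsUnique_continuousMap_lifts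
    (⟨φ, hφ⟩ : C(ℝ, ℂ)) (a₀ := 0) (e₀ := Complex.log (φ 0))
    (by simpa using Complex.exp_log (h0 0)) (by simpa using h0)
  have hLe : ∀ t, Complex.exp (L t) = φ t := fun t => congrFun hL t
  have : Complex.exp (L T) = Complex.exp (L 0) := by rw [hLe, hLe, hT]
  obtain ⟨n, hn⟩ := Complex.exp_eq_exp_iff_exists_int.1 this
  exact ⟨n, L, L.continuous, hLe, by rw [hn]; ring⟩

theorem of_norm_sub_lt (h : HasWinding T φ n) (hφ : Continuous φ) (hψ : Continuous ψ)
    (hT : ψ T = ψ 0)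
    (hlt : ∀ t, ‖ψ t - φ t‖ < ‖φ t‖) : HasWinding T ψ n := by
  have h1 : HasWinding T (fun t => 1 + (ψ t - φ t) / φ t) 0 := by
    refine of_mem_slitPlane ?_ (fun t => ?_) (by rw [hT, h.apply_eq])
    · exact continuous_const.add ((hψ.sub hφ).div hφ h.ne_zero)
    · apply Complex.mem_slitPlane_of_norm_lt_one
      rw [norm_div, div_lt_one (norm_pos_iff.2 (h.ne_zero t))]
      exact hlt t
  have h2 := h.mul h1
  convert h2 using 2 with t
  · have := h.ne_zero t
    field_simp
    ring
  · simp

/-- On a torus of nonvanishing values the diagonal winds as often as the two factors together. -/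
theorem diag {F : ℝ → ℝ → ℂ} (hF : Continuous (Function.uncurry F)) (h0 : ∀ s t, F s t ≠ 0)
    (h₁ : HasWinding T (fun s => F s T) m) (h₂ : HasWinding T (fun t => F 0 t) n) :
    HasWinding T (fun t => F t t) (m + n) := by
  obtain ⟨L, ⟨-, hL⟩, -⟩ := Complex.isCoveringMapOn_exp.existsUnique_continuousMap_lifts
    (⟨Function.uncurry F, hF⟩ : C(ℝ × ℝ, ℂ)) (a₀ := (0, 0)) (e₀ := Complex.log (F 0 0))
    (by simpa using Complex.exp_log (h0 0 0)) (by simpa using h0)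
  have hLe : ∀ s t, Complex.exp (L (s, t)) = F s t := fun s t => congrFun hL (s, t)
  have key : ∀ (c : ℝ → ℝ × ℝ) (k : ℤ), Continuous c →
      HasWinding T (fun t => Function.uncurry F (c t)) k →
      L (c T) - L (c 0) = k * (2 * Real.pi * Complex.I) := by
    intro c k hc hk
    obtain ⟨l, hl⟩ : ∃ l : ℤ, L (c T) - L (c 0) = l * (2 * Real.pi * Complex.I) := by
      obtain ⟨n, hn⟩ := Complex.exp_eq_exp_iff_exists_int.1
        (((hLe (c T).1 (c T).2).trans hk.apply_eq).trans (hLe (c 0).1 (c 0).2).symm)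
      exact ⟨n, by rw [hn]; ring⟩
    have : HasWinding T (fun t => Function.uncurry F (c t)) l :=
      ⟨fun t => L (c t), L.continuous.comp hc, fun t => hLe _ _, hl⟩
    rw [hl, this.unique hk]
  have k1 := key (fun s => (s, T)) m (by fun_prop) h₁
  have k2 := key (fun t => (0, t)) n (by fun_prop) h₂
  refine ⟨fun t => L (t, t), by fun_prop, fun t => hLe t t, ?_⟩
  push_cast
  linear_combination k1 + k2

end HasWinding

/-- The winding number of `φ` along `[0, T]` around `0`, with value `0` if it does not exist. -/
noncomputable def winding (T : ℝ) (φ : ℝ → ℂ) : ℤ :=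
  open Classical in if h : ∃ n, HasWinding T φ n then h.choose else 0

theorem HasWinding.winding_eq {T : ℝ} {φ : ℝ → ℂ} {n : ℤ} (h : HasWinding T φ n) :
    winding T φ = n := by
  have h' : ∃ n, HasWinding T φ n := ⟨n, h⟩
  rw [winding, dif_pos h']
  exact h'.choose_spec.unique h

theorem hasWinding_winding {T : ℝ} {φ : ℝ → ℂ} (hφ : Continuous φ) (h0 : ∀ t, φ t ≠ 0)
    (hT : φ T = φ 0) : HasWinding T φ (winding T φ) := by
  obtain ⟨n, hn⟩ := HasWinding.exists_of_ne_zero hφ h0 hT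
  rwa [hn.winding_eq]

theorem hasWinding_eval {T : ℝ} {η : ℝ → ℂ} (hη : Continuous η) (hT : η T = η 0)
    {q : ℂ[X]} (hq : ∀ t, q.eval (η t) ≠ 0) :
    HasWinding T (fun t => q.eval (η t))
      (q.roots.map fun a => winding T fun t => η t - a).sum := by
  have hq0 : q ≠ 0 := by
    rintro rfl
    simpa using hq 0
  have hroot : ∀ a ∈ q.roots, ∀ t, η t - a ≠ 0 := by
    intro a ha t h
    rw [sub_eq_zero] at h
    exact hq t (by rw [h]; exact (mem_roots hq0).1 ha)
  have hprod : ∀ s : Multiset ℂ, (∀ a ∈ s, ∀ t, η t - a ≠ 0) →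
      HasWinding T (fun t => (s.map fun a => η t - a).prod)
        (s.map fun a => winding T fun t => η t - a).sum := by
    intro s
    induction s using Multiset.induction_on with
    | empty => intro _; simpa using HasWinding.const one_ne_zero
    | cons a s ih =>
      intro h
      have h1 := hasWinding_winding (T := T) (φ := fun t => η t - a) (by fun_prop)
        (h a (by simp)) (by simp [hT])
      have h2 := h1.mul (ih fun b hb => h b (by simp [hb]))
      simpa using h2
  have h := (HasWinding.const (T := T) (leadingCoeff_ne_zero.2 hq0)).mul (hprod _ hroot)
  rw [zero_add] at h
  convert h using 2 with t
  conv_lhs => rw [(IsAlgClosed.splits q).eq_prod_roots]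
  simp [eval_mul, eval_multiset_prod, Multiset.map_map]

/-- Winding numbers are locally constant off a closed set containing the curve. -/
theorem eventually_winding_eq {T : ℝ} {η : ℝ → ℂ} (hη : Continuous η) (hT : η T = η 0)
    {C : Set ℂ} (hC : IsClosed C) (hηC : ∀ t, η t ∈ C) {a : ℂ} (ha : a ∉ C) :
    ∀ᶠ b in 𝓝 a, (winding T fun t => η t - b) = winding T fun t => η t - a := by
  obtain ⟨δ, hδ, hball⟩ := Metric.isOpen_iff.1 hC.isOpen_compl a ha
  filter_upwards [Metric.ball_mem_nhds a hδ] with b hb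
  have hdist : ∀ t, δ ≤ ‖η t - a‖ := fun t => by
    by_contra! h
    exact hball (mem_ball_iff_norm.2 h) (hηC t)
  have h1 := hasWinding_winding (T := T) (φ := fun t => η t - a) (by fun_prop)
    (fun t => norm_pos_iff.1 (hδ.trans_le (hdist t))) (by simp [hT])
  refine (h1.of_norm_sub_lt (by fun_prop) (by fun_prop) (by simp [hT])
    fun t => lt_of_lt_of_le ?_ (hdist t)).winding_eq
  rw [mem_ball_iff_norm] at hb
  rwa [sub_sub_sub_cancel_left, norm_sub_rev]

theorem winding_eq_of_isPreconnected {T : ℝ} {η : ℝ → ℂ} (hη : Continuous η) (hT : η T = η 0)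
    {C S : Set ℂ} (hC : IsClosed C) (hηC : ∀ t, η t ∈ C) (hS : IsPreconnected S)
    (hSC : Disjoint S C) {a b : ℂ} (ha : a ∈ S) (hb : b ∈ S) :
    (winding T fun t => η t - a) = winding T fun t => η t - b := by
  refine hS.constant (f := fun a => winding T fun t => η t - a) ?_ ha hb
  intro x hx
  have := eventually_winding_eq hη hT hC hηC (Set.disjoint_left.1 hSC hx)
  exact (tendsto_nhds_of_eventually_eq this).mono_left nhdsWithin_le_nhds

theorem winding_eq_zero_of_norm_lt {T : ℝ} {η : ℝ → ℂ} (hη : Continuous η) (hT : η T = η 0)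
    {a : ℂ} (ha : ∀ t, ‖η t‖ < ‖a‖) : (winding T fun t => η t - a) = 0 := by
  have ha0 : a ≠ 0 := norm_pos_iff.1 ((norm_nonneg _).trans_lt (ha 0))
  exact ((HasWinding.const (T := T) (neg_ne_zero.2 ha0)).of_norm_sub_lt continuous_const
    (by fun_prop) (by simp [hT]) (by simpa using ha)).winding_eq

theorem exists_norm_eval_gt {P : ℂ[X]} (hP : P.natDegree ≠ 0) {a : ℂ} {s : Set ℂ}
    (hs : s ∈ 𝓝 a) : ∃ b ∈ s, ‖P.eval a‖ < ‖P.eval b‖ := by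
  have himg := (P.isOpenQuotientMap_eval hP).isOpenMap.image_mem_nhds hs
  by_contra! h
  have hsub : P.eval '' s ⊆ closedBall 0 ‖P.eval a‖ := by
    rintro _ ⟨b, hb, rfl⟩
    simpa using h b hb
  have h1 := mem_interior_iff_mem_nhds.2 (mem_of_superset himg hsub)
  by_cases h0 : P.eval a = 0
  · rw [h0] at h1
    simp at h1
  · rw [interior_closedBall _ (norm_ne_zero_iff.2 h0)] at h1
    simp at h1

/-- The maximum principle, for winding numbers: a curve inside `{‖P‖ ≤ ρ}` does not wind
around any point of `{‖P‖ > ρ}`. -/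
theorem winding_eq_zero_of_norm_eval_lt {P : ℂ[X]} (hP : P.natDegree ≠ 0) {T ρ : ℝ} {η : ℝ → ℂ}
    (hη : Continuous η) (hT : η T = η 0) (hρ : ∀ t, ‖P.eval (η t)‖ ≤ ρ) {a : ℂ}
    (ha : ρ < ‖P.eval a‖) : (winding T fun t => η t - a) = 0 := by
  have hprop := P.isProperMap_eval (natDegree_pos_iff_degree_pos.1 (Nat.pos_of_ne_zero hP))
  have hCc : IsCompact (P.eval ⁻¹' closedBall 0 ρ) :=
    hprop.isCompact_preimage (isCompact_closedBall 0 ρ)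
  have hηC : ∀ t, η t ∈ P.eval ⁻¹' closedBall 0 ρ := fun t => by simpa using hρ t
  obtain ⟨M, hM⟩ := hCc.isBounded.exists_norm_le
  by_contra hna
  set E : Set ℂ := {b | ‖P.eval a‖ ≤ ‖P.eval b‖ ∧ (winding T fun t => η t - b) ≠ 0} with hE
  have hloc : ∀ b, ‖P.eval a‖ ≤ ‖P.eval b‖ →
      ∀ᶠ c in 𝓝 b, (winding T fun t => η t - c) = winding T fun t => η t - b := fun b hb =>
    eventually_winding_eq hη hT hCc.isClosed hηC (by simpa using ha.trans_le hb)
  have hEcl : IsClosed E := by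
    rw [← isOpen_compl_iff, isOpen_iff_mem_nhds]
    intro b hb
    by_cases hab : ‖P.eval a‖ ≤ ‖P.eval b‖
    · have hb0 : (winding T fun t => η t - b) = 0 := by
        by_contra h
        exact hb ⟨hab, h⟩
      filter_upwards [hloc b hab] with c hc hcE
      exact hcE.2 (hc.trans hb0)
    · have : IsOpen {c | ‖P.eval c‖ < ‖P.eval a‖} :=
        isOpen_lt (P.continuous.norm) continuous_const
      filter_upwards [this.mem_nhds (not_le.1 hab)] with c hc hcE
      exact not_le.2 hc hcE.1
  have hEb : E ⊆ closedBall 0 M := by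
    intro b hb
    by_contra h
    rw [mem_closedBall_zero_iff, not_le] at h
    exact hb.2 (winding_eq_zero_of_norm_lt hη hT fun t => (hM _ (hηC t)).trans_lt h)
  have hEc : IsCompact E := (isCompact_closedBall 0 M).of_isClosed_subset hEcl hEb
  obtain ⟨b, hbE, hmax⟩ := hEc.exists_isMaxOn ⟨a, le_rfl, hna⟩ P.continuous.norm.continuousOn
  obtain ⟨c, hc, hbc⟩ := exists_norm_eval_gt hP (hloc b hbE.1)
  refine not_le.2 hbc (hmax ⟨hbE.1.trans hbc.le, ?_⟩)
  rw [mem_ofPred_eq] at hc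
  rw [hc]
  exact hbE.2

/-- The open region bounded by the lemniscate `‖P z‖ = R`. -/
def sublevel (P : ℂ[X]) (R : ℝ) : Set ℂ := {z | ‖P.eval z‖ < R}

theorem mem_sublevel {P : ℂ[X]} {R : ℝ} {z : ℂ} : z ∈ sublevel P R ↔ ‖P.eval z‖ < R := Iff.rfl

theorem isOpen_sublevel (P : ℂ[X]) (R : ℝ) : IsOpen (sublevel P R) :=
  isOpen_lt P.continuous.norm continuous_const

theorem isCompact_norm_eval_le {P : ℂ[X]} (hP : P.natDegree ≠ 0) (R : ℝ) :
    IsCompact {z | ‖P.eval z‖ ≤ R} := by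
  have h := (P.isProperMap_eval (natDegree_pos_iff_degree_pos.1
    (Nat.pos_of_ne_zero hP))).isCompact_preimage (isCompact_closedBall 0 R)
  convert h using 1
  ext z
  simp

theorem isBounded_sublevel {P : ℂ[X]} (hP : P.natDegree ≠ 0) (R : ℝ) :
    Bornology.IsBounded (sublevel P R) :=
  (isCompact_norm_eval_le hP R).isBounded.subset fun _ h => (mem_sublevel.1 h).le

theorem isOpen_component (P : ℂ[X]) (R : ℝ) (x : ℂ) :
    IsOpen (connectedComponentIn (sublevel P R) x) :=
  (isOpen_sublevel P R).connectedComponentIn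

theorem norm_eval_le_of_mem_closure_component {P : ℂ[X]} {R : ℝ} {x z : ℂ}
    (hz : z ∈ closure (connectedComponentIn (sublevel P R) x)) : ‖P.eval z‖ ≤ R :=
  closure_minimal (t := {z | ‖P.eval z‖ ≤ R})
    (fun _ h => (mem_sublevel.1 (connectedComponentIn_subset _ _ h)).le)
    (isClosed_le P.continuous.norm continuous_const) hz

theorem mem_component_of_mem_closure {F : Set ℂ} (hF : IsOpen F) {x z : ℂ}
    (hz : z ∈ closure (connectedComponentIn F x)) (hzR : z ∈ F) :
    z ∈ connectedComponentIn F x := by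
  obtain ⟨y, hy, hyx⟩ := mem_closure_iff.1 hz _ (hF.connectedComponentIn (x := z))
    (mem_connectedComponentIn hzR)
  rw [connectedComponentIn_eq hyx, ← connectedComponentIn_eq hy]
  exact mem_connectedComponentIn hzR

theorem exists_norm_eval_eq_of_component {P : ℂ[X]} (hP : P.natDegree ≠ 0) {R : ℝ} {x : ℂ}
    (hx : x ∈ sublevel P R) :
    ∃ b ∈ closure (connectedComponentIn (sublevel P R) x), ‖P.eval b‖ = R := by
  set U := connectedComponentIn (sublevel P R) x with hU
  have hbd : Bornology.IsBounded U :=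
    (isBounded_sublevel hP R).subset (connectedComponentIn_subset _ _)
  have hne : U ≠ univ := fun h => by
    rw [h] at hbd
    exact NoncompactSpace.noncompact_univ (X := ℂ) (by simpa using hbd.isCompact_closure)
  obtain ⟨b, hb⟩ := nonempty_frontier_iff.2 ⟨⟨x, mem_connectedComponentIn hx⟩, hne⟩
  rw [(isOpen_component P R x).frontier_eq] at hb
  refine ⟨b, hb.1, le_antisymm (norm_eval_le_of_mem_closure_component hb.1) ?_⟩
  by_contra! h
  exact hb.2 (mem_component_of_mem_closure (isOpen_sublevel P R) hb.1 h)

theorem exists_nhds_component_eq {P : ℂ[X]} {R : ℝ} {b : ℂ} (hb : P.derivative.eval b ≠ 0) :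
    ∃ W ∈ 𝓝 b, ∀ u ∈ W, u ∈ sublevel P R → ∀ v ∈ W, v ∈ sublevel P R →
      v ∈ connectedComponentIn (sublevel P R) u := by
  have h := P.hasStrictDerivAt b
  set e := (h.hasStrictFDerivAt_equiv hb).toOpenPartialHomeomorph P.eval with he
  have hbs : b ∈ e.source := HasStrictFDerivAt.mem_toOpenPartialHomeomorph_source _
  have hcoe : ∀ z, e z = P.eval z := fun z => rfl
  obtain ⟨r, hr, hball⟩ := Metric.isOpen_iff.1 e.open_target _ (e.map_source hbs)
  have hS : IsPreconnected (e.symm '' (ball (e b) r ∩ ball 0 R)) :=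
    ((convex_ball _ _).inter (convex_ball _ _)).isPreconnected.image _
      (e.continuousOn_symm.mono (inter_subset_left.trans hball))
  have hSD : e.symm '' (ball (e b) r ∩ ball 0 R) ⊆ sublevel P R := by
    rintro _ ⟨w, ⟨hw, hwR⟩, rfl⟩
    rw [mem_sublevel, ← hcoe, e.right_inv (hball hw)]
    simpa using hwR
  have hmem : ∀ u ∈ e.source ∩ P.eval ⁻¹' ball (e b) r, u ∈ sublevel P R →
      u ∈ e.symm '' (ball (e b) r ∩ ball 0 R) := fun u hu huR =>
    ⟨e u, ⟨hu.2, by simpa [hcoe] using mem_sublevel.1 huR⟩, e.left_inv hu.1⟩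
  refine ⟨e.source ∩ P.eval ⁻¹' ball (e b) r, inter_mem (e.open_source.mem_nhds hbs)
    (P.continuous.continuousAt.preimage_mem_nhds (ball_mem_nhds _ hr)), ?_⟩
  intro u hu huR v hv hvR
  exact hS.subset_connectedComponentIn (hmem u hu huR) hSD (hmem v hv hvR)

theorem mem_closure_sublevel {P : ℂ[X]} (hP : P.natDegree ≠ 0) {R : ℝ} (hR : 0 < R) {z : ℂ}
    (hz : ‖P.eval z‖ = R) : z ∈ closure (sublevel P R) := by
  rw [mem_closure_iff_nhds]
  intro s hs
  have himg := (P.isOpenQuotientMap_eval hP).isOpenMap.image_mem_nhds hs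
  have : P.eval z ∈ closure (ball (0 : ℂ) R) := by
    rw [closure_ball _ hR.ne']
    simp [hz]
  obtain ⟨_, ⟨w, hw, rfl⟩, hwR⟩ := mem_closure_iff_nhds.1 this _ himg
  exact ⟨w, hw, mem_sublevel.2 (by simpa using hwR)⟩

/-- Distinct components of a lemniscate region have boundary points that are not shared, when the
lemniscate is smooth. -/
theorem exists_outside_of_notMem_component {P : ℂ[X]} (hP : P.natDegree ≠ 0) {R : ℝ}
    (hcrit : ∀ z, ‖P.eval z‖ = R → P.derivative.eval z ≠ 0) {x a : ℂ}
    (ha : a ∈ sublevel P R) (hax : a ∉ connectedComponentIn (sublevel P R) x) :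
    ∃ b ∈ closure (connectedComponentIn (sublevel P R) a), ‖P.eval b‖ = R ∧
      b ∉ closure (connectedComponentIn (sublevel P R) x) := by
  obtain ⟨b, hb, hbR⟩ := exists_norm_eval_eq_of_component hP ha
  refine ⟨b, hb, hbR, fun hbx => hax ?_⟩
  obtain ⟨W, hW, hWc⟩ := exists_nhds_component_eq (R := R) (hcrit b hbR)
  obtain ⟨u, huW, hu⟩ := mem_closure_iff_nhds.1 hb W hW
  obtain ⟨v, hvW, hv⟩ := mem_closure_iff_nhds.1 hbx W hW
  have h := hWc v hvW (connectedComponentIn_subset _ _ hv) u huW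
    (connectedComponentIn_subset _ _ hu)
  rw [connectedComponentIn_eq hv, connectedComponentIn_eq h, ← connectedComponentIn_eq hu]
  exact mem_connectedComponentIn ha

theorem exists_nhds_inter_subset_component {P : ℂ[X]} {R : ℝ} {x b : ℂ}
    (hb : P.derivative.eval b ≠ 0) (hbx : b ∈ closure (connectedComponentIn (sublevel P R) x)) :
    ∃ W ∈ 𝓝 b, W ∩ sublevel P R ⊆ connectedComponentIn (sublevel P R) x := by
  obtain ⟨W, hW, hWc⟩ := exists_nhds_component_eq (R := R) hb
  refine ⟨W, hW, fun v hv => ?_⟩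
  obtain ⟨u, huW, hu⟩ := mem_closure_iff_nhds.1 hbx W hW
  rw [connectedComponentIn_eq hu]
  exact hWc u huW (connectedComponentIn_subset _ _ hu) v hv.1 hv.2

/-- A curve along a smooth lemniscate that starts on the boundary of a component stays there. -/
theorem mem_closure_component_of_curve {P : ℂ[X]} (hP : P.natDegree ≠ 0) {R : ℝ} (hR : 0 < R)
    (hcrit : ∀ z, ‖P.eval z‖ = R → P.derivative.eval z ≠ 0) {x : ℂ} {γ : ℝ → ℂ}
    (hγ : Continuous γ) (hγR : ∀ t, ‖P.eval (γ t)‖ = R)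
    (h0 : γ 0 ∈ closure (connectedComponentIn (sublevel P R) x)) (t : ℝ) :
    γ t ∈ closure (connectedComponentIn (sublevel P R) x) := by
  set U := connectedComponentIn (sublevel P R) x
  have hcl : IsClopen (γ ⁻¹' closure U) := by
    refine ⟨isClosed_closure.preimage hγ, ?_⟩
    rw [isOpen_iff_mem_nhds]
    intro s hs
    obtain ⟨W, hW, hWU⟩ := exists_nhds_inter_subset_component (hcrit _ (hγR s)) hs
    filter_upwards [hγ.continuousAt.preimage_mem_nhds (interior_mem_nhds.2 hW)] with u hu
    refine closure_mono ((inter_subset_inter_left _ interior_subset).trans hWU)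
      (isOpen_interior.inter_closure ⟨hu, mem_closure_sublevel hP hR (hγR u)⟩)
  have := hcl.eq_univ ⟨0, h0⟩
  exact this.ge (mem_univ t)

/-- A closed curve running along the boundary of a component of a smooth lemniscate region. -/
theorem exists_boundary_curve {P : ℂ[X]} (hP : P.natDegree ≠ 0) {R : ℝ} (hR : 0 < R)
    (hcrit : ∀ z, ‖P.eval z‖ = R → P.derivative.eval z ≠ 0) {x : ℂ} (hx : x ∈ sublevel P R) :
    ∃ (T : ℝ) (γ : ℝ → ℂ) (n : ℤ), Continuous γ ∧ γ T = γ 0 ∧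
      (∀ t, γ t ∈ closure (connectedComponentIn (sublevel P R) x)) ∧
      (∀ t, ‖P.eval (γ t)‖ = R) ∧ HasWinding T (fun t => P.eval (γ t)) n ∧ n ≠ 0 := by
  obtain ⟨z, hz, hzR⟩ := exists_norm_eval_eq_of_component hP hx
  let φ : C(ℝ, ℂ) := ⟨fun t => P.eval z * Complex.exp (t * Complex.I), by fun_prop⟩
  have hφ : ∀ t, φ t = P.eval z * Complex.exp (t * Complex.I) := fun _ => rfl
  have hφR : ∀ t, ‖φ t‖ = R := fun t => by
    rw [hφ, norm_mul, hzR, Complex.norm_exp_ofReal_mul_I, mul_one]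
  obtain ⟨δ, ⟨hδ0, hδ⟩, -⟩ := P.isCoveringMapOn_eval.existsUnique_continuousMap_lifts φ
    (a₀ := 0) (e₀ := z) (by simp [hφ]) (by
      rintro t ⟨c, hc, hct⟩
      refine hcrit c ?_ hc
      rw [← hφR t, ← hct])
  have hδe : ∀ t, P.eval (δ t) = P.eval z * Complex.exp (t * Complex.I) := fun t => congrFun hδ t
  have hδR : ∀ t, ‖P.eval (δ t)‖ = R := fun t => by rw [hδe, ← hφ, hφR]
  have hδU := mem_closure_component_of_curve hP hR hcrit δ.continuous hδR (by rwa [hδ0])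
  have hper : ∀ n : ℕ, Complex.exp (((2 * Real.pi * n : ℝ) : ℂ) * Complex.I) = 1 := fun n => by
    rw [Complex.exp_eq_one_iff]
    exact ⟨n, by push_cast; ring⟩
  have hne : P - C (P.eval z) ≠ 0 := fun h => hP (by
    rw [sub_eq_zero.1 h, natDegree_C])
  obtain ⟨a, b, hab, hδab⟩ := (P - C (P.eval z)).rootSet_finite ℂ
    |>.exists_lt_map_eq_of_forall_mem (f := fun n : ℕ => δ (2 * Real.pi * n)) (fun n => by
      rw [mem_rootSet]
      refine ⟨hne, ?_⟩
      have := hδe (2 * Real.pi * n)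
      rw [hper, mul_one] at this
      simp [this])
  have hz0 : P.eval z ≠ 0 := norm_pos_iff.1 (hzR ▸ hR)
  refine ⟨2 * Real.pi * (b - a), fun t => δ (t + 2 * Real.pi * a), b - a, by fun_prop, ?_,
    fun t => hδU _, fun t => hδR _, ⟨fun t => Complex.log (P.eval z) + t * Complex.I,
      by fun_prop, fun t => ?_, ?_⟩, by lia⟩
  · simp only [zero_add]
    rw [hδab]
    ring_nf
  · rw [Complex.exp_add, Complex.exp_log hz0]
    beta_reduce
    rw [hδe]
    have := hper a
    push_cast at this ⊢
    rw [add_mul, Complex.exp_add, this, mul_one]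
  · push_cast
    ring

theorem winding_eq_zero_of_notMem_component {P : ℂ[X]} (hP : P.natDegree ≠ 0) {R : ℝ}
    (hcrit : ∀ z, ‖P.eval z‖ = R → P.derivative.eval z ≠ 0) {x : ℂ} {T : ℝ} {γ : ℝ → ℂ}
    (hγ : Continuous γ) (hT : γ T = γ 0)
    (hγU : ∀ t, γ t ∈ closure (connectedComponentIn (sublevel P R) x))
    (hγR : ∀ t, ‖P.eval (γ t)‖ = R) {a : ℂ} (haR : ‖P.eval a‖ ≠ R)
    (ha : a ∉ connectedComponentIn (sublevel P R) x) : (winding T fun t => γ t - a) = 0 := by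
  have hext : ∀ c, R < ‖P.eval c‖ → (winding T fun t => γ t - c) = 0 := fun c hc =>
    winding_eq_zero_of_norm_eval_lt hP hγ hT (fun t => (hγR t).le) hc
  rcases haR.lt_or_gt with h | h
  swap
  · exact hext a h
  obtain ⟨b, hb, hbR, hbx⟩ := exists_outside_of_notMem_component hP hcrit h ha
  have hloc := eventually_winding_eq hγ hT isClosed_closure hγU hbx
  obtain ⟨c, hc, hbc⟩ := exists_norm_eval_gt hP hloc
  obtain ⟨u, hu, hua⟩ := mem_closure_iff_nhds.1 hb _ hloc
  rw [mem_ofPred_eq] at hc hu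
  have hsep : Disjoint (connectedComponentIn (sublevel P R) a) {z | ‖P.eval z‖ = R} := by
    rw [Set.disjoint_left]
    intro z hz hz'
    exact (mem_sublevel.1 (connectedComponentIn_subset _ _ hz)).ne hz'
  rw [winding_eq_of_isPreconnected hγ hT (isClosed_eq P.continuous.norm continuous_const) hγR
    isPreconnected_connectedComponentIn hsep (mem_connectedComponentIn h) hua, hu, ← hc]
  exact hext c (hbR ▸ hbc)

/-- A closed curve along the boundary of a component `U` of a smooth lemniscate region, which winds
a constant nonzero number of times around the points of `U` and does not wind around other points. -/
theorem exists_boundary_curve_winding {P : ℂ[X]} (hP : P.natDegree ≠ 0) {R : ℝ} (hR : 0 < R)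
    (hcrit : ∀ z, ‖P.eval z‖ = R → P.derivative.eval z ≠ 0) {x : ℂ} (hx : x ∈ sublevel P R) :
    ∃ (T : ℝ) (γ : ℝ → ℂ) (n : ℤ), Continuous γ ∧ γ T = γ 0 ∧
      (∀ t, γ t ∈ closure (connectedComponentIn (sublevel P R) x)) ∧
      (∀ t, ‖P.eval (γ t)‖ = R) ∧ n ≠ 0 ∧
      (∀ a ∈ connectedComponentIn (sublevel P R) x, (winding T fun t => γ t - a) = n) ∧
      (∀ a ∉ connectedComponentIn (sublevel P R) x, ‖P.eval a‖ ≠ R →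
        (winding T fun t => γ t - a) = 0) := by
  obtain ⟨T, γ, m, hγ, hT, hγU, hγR, hm, hm0⟩ := exists_boundary_curve hP hR hcrit hx
  have hsep : Disjoint (connectedComponentIn (sublevel P R) x) {z | ‖P.eval z‖ = R} := by
    rw [Set.disjoint_left]
    intro z hz hz'
    exact (mem_sublevel.1 (connectedComponentIn_subset _ _ hz)).ne hz'
  have hin : ∀ a ∈ connectedComponentIn (sublevel P R) x,
      (winding T fun t => γ t - a) = winding T fun t => γ t - x := fun a ha =>
    winding_eq_of_isPreconnected hγ hT (isClosed_eq P.continuous.norm continuous_const) hγR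
      isPreconnected_connectedComponentIn hsep ha (mem_connectedComponentIn hx)
  have hout : ∀ a ∉ connectedComponentIn (sublevel P R) x, ‖P.eval a‖ ≠ R →
      (winding T fun t => γ t - a) = 0 := fun a ha haR =>
    winding_eq_zero_of_notMem_component hP hcrit hγ hT hγU hγR haR ha
  refine ⟨T, γ, _, hγ, hT, hγU, hγR, fun h0 => hm0 ?_, hin, hout⟩
  have hroots := hasWinding_eval hγ hT (q := P) fun t => norm_pos_iff.1 (by rw [hγR]; exact hR)
  rw [hm.unique hroots]
  refine Multiset.sum_eq_zero fun k hk => ?_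
  obtain ⟨a, ha, rfl⟩ := Multiset.mem_map.1 hk
  by_cases haU : a ∈ connectedComponentIn (sublevel P R) x
  · rw [hin a haU, h0]
  · refine hout a haU ?_
    rw [(mem_roots'.1 ha).2, norm_zero]
    exact hR.ne

theorem exists_continuous_divided_difference (q : ℂ[X]) :
    ∃ Φ : ℂ → ℂ → ℂ, Continuous (Function.uncurry Φ) ∧
      (∀ u v, q.eval u - q.eval v = (u - v) * Φ u v) ∧ ∀ u, Φ u u = q.derivative.eval u := by
  induction q using Polynomial.induction_on' with
  | add p q hp hq =>
    obtain ⟨Φ, hΦ, hΦe, hΦd⟩ := hp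
    obtain ⟨Ψ, hΨ, hΨe, hΨd⟩ := hq
    refine ⟨fun u v => Φ u v + Ψ u v, hΦ.add hΨ, fun u v => ?_, fun u => ?_⟩
    · rw [eval_add, eval_add]
      linear_combination hΦe u v + hΨe u v
    · beta_reduce
      rw [hΦd, hΨd, derivative_add, eval_add]
  | monomial n a =>
    refine ⟨fun u v => a * ∑ i ∈ Finset.range n, u ^ i * v ^ (n - 1 - i), ?_, fun u v => ?_,
      fun u => ?_⟩
    · unfold Function.uncurry
      fun_prop
    · rw [eval_monomial, eval_monomial]
      linear_combination (-a) * geom_sum₂_mul u v n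
    · beta_reduce
      rw [geom_sum₂_self, derivative_monomial, eval_monomial]
      ring

/-- Near a smooth lemniscate, Newton's method for `P` pushes the lemniscate inside. -/
theorem eventually_push {P : ℂ[X]} (hP : P.natDegree ≠ 0) {R : ℝ} (hR : 0 < R)
    (hcrit : ∀ z, ‖P.eval z‖ = R → P.derivative.eval z ≠ 0) {Ψ : ℂ → ℂ → ℂ}
    (hΨ : Continuous (Function.uncurry Ψ)) (hΨ0 : ∀ z, ‖P.eval z‖ = R → Ψ z z ≠ 0) :
    ∀ᶠ ε : ℝ in 𝓝[>] 0, ∀ z, ‖P.eval z‖ = R →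
      ‖P.eval (z - ε * (P.eval z / P.derivative.eval z))‖ < R ∧
      ‖Ψ (z - ε * (P.eval z / P.derivative.eval z)) z - Ψ z z‖ < ‖Ψ z z‖ := by
  obtain ⟨Φ, hΦ, hΦe, hΦd⟩ := exists_continuous_divided_difference P
  have hL : IsCompact {z | ‖P.eval z‖ = R} :=
    (isCompact_norm_eval_le hP R).of_isClosed_subset
      (isClosed_eq P.continuous.norm continuous_const) fun z hz => le_of_eq hz
  have key : ∀ᶠ ε : ℝ in 𝓝 0, ∀ z ∈ {z | ‖P.eval z‖ = R},
      ‖P.eval z - P.eval z / P.derivative.eval z *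
          Φ (z - ε * (P.eval z / P.derivative.eval z)) z‖ < ‖P.eval z‖ ∧
      ‖Ψ (z - ε * (P.eval z / P.derivative.eval z)) z - Ψ z z‖ < ‖Ψ z z‖ := by
    refine hL.eventually_forall_of_forall_eventually fun z hz => ?_
    have hz' : P.derivative.eval z ≠ 0 := hcrit z hz
    have hc : ContinuousAt (fun q : ℝ × ℂ => P.eval q.2 / P.derivative.eval q.2) (0, z) :=
      ContinuousAt.div (by fun_prop) (by fun_prop) hz'
    have hc2 : ContinuousAt (fun q : ℝ × ℂ =>
        (q.2 - (q.1 : ℂ) * (P.eval q.2 / P.derivative.eval q.2), q.2)) (0, z) :=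
      (continuousAt_snd.sub (ContinuousAt.mul (by fun_prop) hc)).prodMk continuousAt_snd
    have hcΦ := ContinuousAt.comp (f := fun q : ℝ × ℂ =>
        (q.2 - (q.1 : ℂ) * (P.eval q.2 / P.derivative.eval q.2), q.2)) (x := (0, z))
        hΦ.continuousAt hc2
    have hcΨ := ContinuousAt.comp (f := fun q : ℝ × ℂ =>
        (q.2 - (q.1 : ℂ) * (P.eval q.2 / P.derivative.eval q.2), q.2)) (x := (0, z))
        hΨ.continuousAt hc2
    have hd : ContinuousAt (fun q : ℝ × ℂ => Ψ q.2 q.2) (0, z) :=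
      (hΨ.comp (continuous_snd.prodMk continuous_snd)).continuousAt
    have hPc : ContinuousAt (fun q : ℝ × ℂ => P.eval q.2) (0, z) := by fun_prop
    refine ((hPc.sub (hc.mul hcΦ)).norm.eventually_lt hPc.norm ?_).and
      ((hcΨ.sub hd).norm.eventually_lt hd.norm ?_)
    · simp only [Pi.sub_apply, Pi.mul_apply, Function.comp_apply, Function.uncurry,
        Complex.ofReal_zero, zero_mul, sub_zero, hΦd]
      rw [div_mul_cancel₀ _ hz', sub_self, norm_zero]
      exact (show ‖P.eval z‖ = R from hz) ▸ hR
    · simpa [Function.uncurry] using hΨ0 z hz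
  filter_upwards [nhdsWithin_le_nhds key, self_mem_nhdsWithin,
    nhdsWithin_le_nhds (Iio_mem_nhds one_pos)] with ε hε hε0 hε1 z hz
  rw [mem_Ioi] at hε0
  rw [mem_Iio] at hε1
  obtain ⟨h1, h2⟩ := hε z hz
  refine ⟨?_, h2⟩
  set v := P.eval z / P.derivative.eval z
  have heq : P.eval (z - ε * v) = ((1 - ε : ℝ) : ℂ) * P.eval z +
      (ε : ℂ) * (P.eval z - v * Φ (z - ε * v) z) := by
    push_cast
    linear_combination hΦe (z - ε * v) z
  rw [heq]
  rw [hz] at h1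
  calc _ ≤ ‖((1 - ε : ℝ) : ℂ) * P.eval z‖ + ‖(ε : ℂ) * (P.eval z - v * Φ (z - ε * v) z)‖ :=
        norm_add_le _ _
    _ = (1 - ε) * R + ε * ‖P.eval z - v * Φ (z - ε * v) z‖ := by
        rw [norm_mul, norm_mul, hz, Complex.norm_real, Complex.norm_real, Real.norm_of_nonneg
          (by linarith), Real.norm_of_nonneg hε0.le]
    _ < (1 - ε) * R + ε * R := by gcongr
    _ = R := by ring

theorem exists_sum_map_eq_nsmul {α : Type*} (M : Multiset α) (g : α → ℤ) (n : ℤ)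
    (h : ∀ a ∈ M, g a = n ∨ g a = 0) : ∃ k : ℕ, (M.map g).sum = k * n := by
  induction M using Multiset.induction_on with
  | empty => exact ⟨0, by simp⟩
  | cons a M ih =>
    obtain ⟨k, hk⟩ := ih fun b hb => h b (by simp [hb])
    rcases h a (by simp) with ha | ha
    · exact ⟨k + 1, by simp [ha, hk]; ring⟩
    · exact ⟨k, by simp [ha, hk]⟩

/-- If `P = Q ∘ p` has a smooth lemniscate `‖P‖ = R` and `p` has no critical point in a component of
`‖P‖ < R`, then `p` is injective on this component. -/
theorem injOn_component_of_comp {P Q p : ℂ[X]} (hPQ : P = Q.comp p) (hP : P.natDegree ≠ 0)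
    {R : ℝ} (hR : 0 < R) (hcrit : ∀ z, ‖P.eval z‖ = R → P.derivative.eval z ≠ 0) {x : ℂ}
    (hx : x ∈ sublevel P R)
    (hp : ∀ u ∈ connectedComponentIn (sublevel P R) x, p.derivative.eval u ≠ 0) :
    InjOn p.eval (connectedComponentIn (sublevel P R) x) := by
  set U := connectedComponentIn (sublevel P R) x with hU
  obtain ⟨T, γ, n, hγ, hT, hγU, hγR, hn, hin, hout⟩ := exists_boundary_curve_winding hP hR hcrit hx
  obtain ⟨Φ, hΦ, hΦe, hΦd⟩ := exists_continuous_divided_difference p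
  have hval : ∀ u v, p.eval u = p.eval v → P.eval u = P.eval v := fun u v h => by
    rw [hPQ, eval_comp, eval_comp, h]
  have hpL : ∀ z, ‖P.eval z‖ = R → p.derivative.eval z ≠ 0 := fun z hz h => hcrit z hz (by
    rw [hPQ, derivative_comp, eval_mul, h, zero_mul])
  have hp0 : ∀ c, p - C c ≠ 0 := fun c h => hP (by
    rw [hPQ, sub_eq_zero.1 h, comp_C, natDegree_C])
  have hroot : ∀ {c a : ℂ}, a ∈ (p - C c).roots → p.eval a = c := fun {c a} h => by
    have := (mem_roots'.1 h).2
    rwa [IsRoot.def, eval_sub, eval_C, sub_eq_zero] at this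
  have hUR : ∀ u ∈ U, ‖P.eval u‖ < R := fun u hu =>
    mem_sublevel.1 (connectedComponentIn_subset _ _ hu)
  obtain ⟨W, hW, hWU⟩ := exists_nhds_inter_subset_component (hcrit _ (hγR 0)) (hγU 0)
  have hWε : ∀ᶠ ε : ℝ in 𝓝[>] 0, γ 0 - ε * (P.eval (γ 0) / P.derivative.eval (γ 0)) ∈ W := by
    refine nhdsWithin_le_nhds (ContinuousAt.preimage_mem_nhds (by fun_prop) ?_)
    simpa using hW
  obtain ⟨ε, hε, hεW⟩ := ((eventually_push hP hR hcrit hΦ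
    fun z hz => by rw [hΦd]; exact hpL z hz).and hWε).exists
  set Γ : ℝ → ℂ := fun t => γ t - ε * (P.eval (γ t) / P.derivative.eval (γ t)) with hΓdef
  have hΓ : Continuous Γ := hγ.sub (continuous_const.mul
    ((P.continuous.comp hγ).div (P.derivative.continuous.comp hγ) fun t => hcrit _ (hγR t)))
  have hΓT : Γ T = Γ 0 := by simp only [hΓdef, hT]
  have hΓU : Γ 0 ∈ U := hWU ⟨hεW, (hε _ (hγR 0)).1⟩
  have hL : IsCompact {z | ‖P.eval z‖ = R} :=
    (isCompact_norm_eval_le hP R).of_isClosed_subset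
      (isClosed_eq P.continuous.norm continuous_const) fun z hz => le_of_eq hz
  obtain ⟨ρ, hρR, hρ⟩ : ∃ ρ < R, ∀ t, ‖P.eval (Γ t)‖ ≤ ρ := by
    have hc : ContinuousOn (fun z => ‖P.eval (z - ε * (P.eval z / P.derivative.eval z))‖)
        {z | ‖P.eval z‖ = R} :=
      (P.continuous.comp_continuousOn (continuousOn_id.sub (continuousOn_const.mul
        (P.continuous.continuousOn.div P.derivative.continuous.continuousOn hcrit)))).norm
    obtain ⟨z, hz, hmax⟩ := hL.exists_isMaxOn ⟨γ 0, hγR 0⟩ hc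
    exact ⟨_, (hε z hz).1, fun t => hmax (hγR t)⟩
  have hΓR : ∀ t, ‖P.eval (Γ t)‖ < R := fun t => (hρ t).trans_lt hρR
  set F : ℝ → ℝ → ℂ := fun s t => Φ (Γ s) (γ t) with hF
  have hFc : Continuous (Function.uncurry F) :=
    hΦ.comp ((hΓ.comp continuous_fst).prodMk (hγ.comp continuous_snd))
  have hF0 : ∀ s t, F s t ≠ 0 := fun s t h => by
    have h1 := hΦe (Γ s) (γ t)
    rw [show Φ (Γ s) (γ t) = 0 from h, mul_zero, sub_eq_zero] at h1
    have h2 := hΓR s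
    rw [hval _ _ h1, hγR] at h2
    exact lt_irrefl _ h2
  have hne : ∀ s t, Γ s - γ t ≠ 0 := fun s t h => by
    have h2 := hΓR s
    rw [sub_eq_zero.1 h, hγR] at h2
    exact lt_irrefl _ h2
  have hFq : ∀ s t, (p.eval (Γ s) - p.eval (γ t)) * (Γ s - γ t)⁻¹ = F s t := fun s t => by
    rw [hΦe]
    field_simp [hne s t]
    rfl
  have hpne : ∀ s t, p.eval (Γ s) - p.eval (γ t) ≠ 0 := fun s t => by
    rw [hΦe]
    exact mul_ne_zero (hne s t) (hF0 s t)
  have h₁ : HasWinding T (fun s => F s T) 0 := by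
    have ha := hasWinding_eval hΓ hΓT (q := p - C (p.eval (γ T))) fun s => by
      simpa using hpne s T
    have hz : ∀ a, ‖P.eval a‖ = R → (winding T fun t => Γ t - a) = 0 := fun a haR =>
      winding_eq_zero_of_norm_eval_lt hP hΓ hΓT hρ (haR ▸ hρR)
    rw [Multiset.sum_eq_zero fun k hk => by
      obtain ⟨a, ha, rfl⟩ := Multiset.mem_map.1 hk
      exact hz a (by rw [hval _ _ (hroot ha), hγR])] at ha
    have hb := hasWinding_winding (T := T) (φ := fun s => Γ s - γ T) (by fun_prop)
      (fun s => hne s T) (by rw [hΓT])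
    rw [hz _ (hγR T)] at hb
    have := ha.mul hb.inv
    rw [neg_zero, add_zero] at this
    convert this using 2 with s
    rw [← hFq]
    simp
  have hcl : ∀ u ∈ U, HasWinding T (fun t => p.eval (γ t) - p.eval u)
      ((p - C (p.eval u)).roots.map fun a => winding T fun t => γ t - a).sum := fun u hu => by
    have := hasWinding_eval hγ hT (q := p - C (p.eval u)) fun t h => by
      rw [eval_sub, eval_C, sub_eq_zero] at h
      have h2 := hUR u hu
      rw [← hval _ _ h, hγR] at h2
      exact lt_irrefl _ h2
    simpa using this
  have h₂ : HasWinding T (fun t => F 0 t)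
      (((p - C (p.eval (Γ 0))).roots.map fun a => winding T fun t => γ t - a).sum + -n) := by
    have hb := hasWinding_winding (T := T) (φ := fun t => γ t - Γ 0) (by fun_prop)
      (fun t => by rw [← neg_sub]; exact neg_ne_zero.2 (hne 0 t)) (by rw [hT])
    rw [hin _ hΓU] at hb
    have := (hcl _ hΓU).mul hb.inv
    convert this using 2 with t
    rw [← hFq, ← neg_sub (p.eval (γ t)), ← neg_sub (γ t), inv_neg, neg_mul_neg]
  have hd : HasWinding T (fun t => F t t) 0 := by
    have hb := hasWinding_eval hγ hT (q := p.derivative) fun t => hpL _ (hγR t)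
    rw [Multiset.sum_eq_zero fun k hk => by
      obtain ⟨c, hc, rfl⟩ := Multiset.mem_map.1 hk
      have hc0 : p.derivative.eval c = 0 := (mem_roots'.1 hc).2
      exact hout c (fun h => hp c h hc0) (fun h => hpL c h hc0)] at hb
    refine hb.of_norm_sub_lt (by fun_prop) (hFc.comp (continuous_id.prodMk continuous_id)) ?_ ?_
    · simp only [hF, hΓT, hT]
    · intro t
      rw [← hΦd]
      exact (hε _ (hγR t)).2
  have hsum := hd.unique (HasWinding.diag hFc hF0 h₁ h₂)
  have hcount : ∀ u ∈ U,
      ((p - C (p.eval u)).roots.map fun a => winding T fun t => γ t - a).sum = n := by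
    intro u hu
    have hsep : Disjoint (p.eval '' U) (p.eval '' {z | ‖P.eval z‖ = R}) := by
      rw [Set.disjoint_left]
      rintro _ ⟨v, hv, rfl⟩ ⟨z, hz, hzv⟩
      have h2 := hUR v hv
      rw [← hval _ _ hzv] at h2
      exact h2.ne hz
    have := winding_eq_of_isPreconnected (T := T) (η := fun t => p.eval (γ t)) (by fun_prop)
      (by rw [hT]) (hL.image p.continuous).isClosed (fun t => mem_image_of_mem _ (hγR t))
      (isPreconnected_connectedComponentIn.image _ p.continuous.continuousOn) hsep
      (mem_image_of_mem _ hu) (mem_image_of_mem _ hΓU)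
    rw [(hcl u hu).winding_eq, (hcl _ hΓU).winding_eq] at this
    lia
  intro u hu v hv huv
  by_contra huv'
  have hmem : ∀ w, p.eval w = p.eval u → w ∈ (p - C (p.eval u)).roots := fun w hw => by
    rw [mem_roots (hp0 _), IsRoot.def, eval_sub, eval_C, hw, sub_self]
  obtain ⟨M, hM⟩ := Multiset.exists_cons_of_mem (hmem u rfl)
  obtain ⟨M', hM'⟩ : ∃ M', M = v ::ₘ M' := by
    refine Multiset.exists_cons_of_mem ?_
    have := hmem v huv.symm
    rw [hM, Multiset.mem_cons] at this
    exact this.resolve_left (Ne.symm huv')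
  have hc := hcount u hu
  obtain ⟨k, hk⟩ := exists_sum_map_eq_nsmul M' (fun a => winding T fun t => γ t - a) n (by
    intro a ha
    by_cases haU : a ∈ U
    · exact Or.inl (hin a haU)
    · refine Or.inr (hout a haU ?_)
      have : a ∈ (p - C (p.eval u)).roots := by rw [hM, hM']; simp [ha]
      rw [hval _ _ (hroot this)]
      exact (hUR u hu).ne)
  rw [hM, hM', Multiset.map_cons, Multiset.map_cons, Multiset.sum_cons, Multiset.sum_cons, hk,
    hin u hu, hin v hv] at hc
  have : ((k : ℤ) + 1) * n = 0 := by linear_combination hc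
  rcases mul_eq_zero.1 this with h | h
  · lia
  · exact hn h

theorem image_connectedComponentIn_preimage {p : ℂ[X]} (hp : p.natDegree ≠ 0) {O : Set ℂ}
    (hO : IsOpen O) {x : ℂ} (hx : p.eval x ∈ O) :
    p.eval '' connectedComponentIn (p.eval ⁻¹' O) x = connectedComponentIn O (p.eval x) := by
  have hpo : IsOpen (p.eval ⁻¹' O) := hO.preimage p.continuous
  have hxU : x ∈ connectedComponentIn (p.eval ⁻¹' O) x := mem_connectedComponentIn hx
  apply Subset.antisymm
  · refine (isPreconnected_connectedComponentIn.image _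
      p.continuous.continuousOn).subset_connectedComponentIn (mem_image_of_mem _ hxU) ?_
    rintro _ ⟨u, hu, rfl⟩
    have := connectedComponentIn_subset _ _ hu
    exact this
  · refine isPreconnected_connectedComponentIn.subset_of_closure_inter_subset
      ((p.isOpenQuotientMap_eval hp).isOpenMap _ hpo.connectedComponentIn)
      ⟨_, mem_connectedComponentIn hx, mem_image_of_mem _ hxU⟩ ?_
    rw [p.isClosedMap_eval.closure_image_eq_of_continuous p.continuous]
    rintro _ ⟨⟨u, hu, rfl⟩, hO'⟩
    have := connectedComponentIn_subset _ _ hO'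
    exact mem_image_of_mem _ (mem_component_of_mem_closure hpo hu this)

/-- The `n`-th iterate of a polynomial. -/
noncomputable def iter (f : ℂ[X]) (n : ℕ) : ℂ[X] := f.comp^[n] X

theorem eval_iter (f : ℂ[X]) (n : ℕ) (z : ℂ) : (iter f n).eval z = (fun w => f.eval w)^[n] z := by
  rw [iter, iterate_comp_eval, eval_X]

theorem eval_iter_add (f : ℂ[X]) (m n : ℕ) (z : ℂ) :
    (iter f (m + n)).eval z = (iter f m).eval ((iter f n).eval z) := by
  rw [eval_iter, eval_iter, eval_iter, Function.iterate_add_apply]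

theorem iter_add (f : ℂ[X]) (m n : ℕ) : iter f (m + n) = (iter f m).comp (iter f n) :=
  Polynomial.funext fun z => by rw [eval_comp, eval_iter_add]

theorem eval_iter_succ (f : ℂ[X]) (n : ℕ) (z : ℂ) :
    (iter f (n + 1)).eval z = f.eval ((iter f n).eval z) := by
  rw [eval_iter, eval_iter, Function.iterate_succ_apply']

theorem iter_zero (f : ℂ[X]) : iter f 0 = X := rfl

theorem natDegree_iter_ne_zero {f : ℂ[X]} (hf : f.natDegree ≠ 0) (n : ℕ) :
    (iter f n).natDegree ≠ 0 := by
  rw [iter, natDegree_iterate_comp, natDegree_X, mul_one]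
  exact pow_ne_zero _ hf

theorem exists_of_derivative_iter_eq_zero {f : ℂ[X]} {n : ℕ} {z : ℂ}
    (h : (iter f n).derivative.eval z = 0) :
    ∃ k < n, f.derivative.eval ((iter f k).eval z) = 0 := by
  induction n with
  | zero => simp [iter_zero] at h
  | succ n ih =>
    have : iter f (n + 1) = f.comp (iter f n) :=
      Polynomial.funext fun z => by rw [eval_comp, eval_iter_succ]
    rw [this, derivative_comp, eval_mul, eval_comp] at h
    rcases mul_eq_zero.1 h with h | h
    · obtain ⟨k, hk, hk'⟩ := ih h
      exact ⟨k, by lia, hk'⟩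
    · exact ⟨n, by lia, h⟩

theorem exists_escape_radius {f : ℂ[X]} (hf : 2 ≤ f.natDegree) :
    ∃ R > 0, ∀ z : ℂ, R ≤ ‖z‖ → 2 * ‖z‖ ≤ ‖f.eval z‖ := by
  have h1 : 0 < f.divX.degree := by
    rw [← natDegree_pos_iff_degree_pos, natDegree_divX_eq_natDegree_tsub_one]
    lia
  have h2 := (f.divX.tendsto_norm_atTop h1 tendsto_norm_cobounded_atTop).eventually_ge_atTop 3
  obtain ⟨r, -, hr⟩ := (hasBasis_cobounded_norm (E := ℂ)).eventually_iff.1 h2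
  refine ⟨max 1 (max r ‖f.coeff 0‖), by positivity, fun z hz => ?_⟩
  have hz0 : ‖f.coeff 0‖ ≤ ‖z‖ := (le_max_right _ _).trans ((le_max_right _ _).trans hz)
  have hz3 : 3 ≤ ‖f.divX.eval z‖ := hr ((le_max_left r _).trans ((le_max_right _ _).trans hz))
  have : f.eval z = f.divX.eval z * z + f.coeff 0 := by
    conv_lhs => rw [← f.divX_mul_X_add]
    simp
  rw [this]
  have h4 := norm_sub_le_norm_add (f.divX.eval z * z) (f.coeff 0)
  rw [norm_mul] at h4
  nlinarith [norm_nonneg z]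

/-- The disc of radius `R` is adapted to `f`: it contains the filled-in Julia set, no critical orbit
meets its boundary, and all critical points leave it after at most `N` steps. -/
structure AdaptedRadius (f : ℂ[X]) (R : ℝ) (N : ℕ) : Prop where
  natDegree_ne_zero : f.natDegree ≠ 0
  pos : 0 < R
  escape : ∀ z : ℂ, R ≤ ‖z‖ → 2 * ‖z‖ ≤ ‖f.eval z‖
  norm_ne : ∀ c, f.derivative.eval c = 0 → ∀ j, ‖(iter f j).eval c‖ ≠ R
  crit_escape : ∀ c, f.derivative.eval c = 0 → R ≤ ‖(iter f N).eval c‖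

/-- The points whose orbit stays in the disc of radius `R`. -/
def trapped (f : ℂ[X]) (R : ℝ) : Set ℂ := {z | ∀ m, ‖(iter f m).eval z‖ < R}

theorem le_norm_iter_of_le {f : ℂ[X]} {R : ℝ} (hR : 0 < R)
    (hesc : ∀ z : ℂ, R ≤ ‖z‖ → 2 * ‖z‖ ≤ ‖f.eval z‖) {z : ℂ} {m : ℕ}
    (h : R ≤ ‖(iter f m).eval z‖) (k : ℕ) : 2 ^ k * R ≤ ‖(iter f (m + k)).eval z‖ := by
  induction k with
  | zero => simpa using h
  | succ k ih =>
    rw [← add_assoc, eval_iter_succ]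
    have h1 : R ≤ 2 ^ k * R := le_mul_of_one_le_left hR.le (one_le_pow₀ one_le_two)
    have := hesc _ (h1.trans ih)
    rw [pow_succ]
    linarith

theorem isBounded_orbit_iff {f : ℂ[X]} {R : ℝ} (hR : 0 < R)
    (hesc : ∀ z : ℂ, R ≤ ‖z‖ → 2 * ‖z‖ ≤ ‖f.eval z‖) (z : ℂ) :
    Bornology.IsBounded (Set.range fun n : ℕ => (fun w : ℂ => f.eval w)^[n] z) ↔
      z ∈ trapped f R := by
  simp only [← eval_iter]
  constructor
  · intro h m
    by_contra! hm
    obtain ⟨M, hM⟩ := h.exists_norm_le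
    obtain ⟨k, hk⟩ := pow_unbounded_of_one_lt (M / R) one_lt_two
    have h1 := le_norm_iter_of_le hR hesc hm k
    have h2 := hM _ (mem_range_self (m + k))
    rw [div_lt_iff₀ hR] at hk
    linarith
  · intro h
    refine (isBounded_ball (x := (0 : ℂ)) (r := R)).subset ?_
    rintro _ ⟨m, rfl⟩
    simpa using h m

theorem exists_adaptedRadius {f : ℂ[X]} (hf : 2 ≤ f.natDegree)
    (hcrit : ∀ c, f.derivative.eval c = 0 →
      ¬ Bornology.IsBounded (Set.range fun n : ℕ => (fun w : ℂ => f.eval w)^[n] c)) :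
    ∃ R N, AdaptedRadius f R N := by
  obtain ⟨R₀, hR₀, hesc₀⟩ := exists_escape_radius hf
  have hd0 : f.derivative ≠ 0 := fun h => by
    have := derivative_eq_zero.1 h
    lia
  have hfin : {c | f.derivative.eval c = 0}.Finite := by
    convert (f.derivative.rootSet_finite ℂ) using 1
    ext c
    simp [mem_rootSet, hd0]
  have hcount : (⋃ c ∈ {c | f.derivative.eval c = 0},
      Set.range fun j : ℕ => ‖(iter f j).eval c‖).Countable :=
    hfin.countable.biUnion fun c _ => countable_range _
  obtain ⟨R, hR, hR₀R⟩ := (hcount.dense_compl ℝ).exists_mem_open isOpen_Ioi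
    (⟨R₀ + 1, by simp⟩ : (Ioi R₀).Nonempty)
  have hRp : 0 < R := hR₀.trans hR₀R
  have hesc : ∀ z : ℂ, R ≤ ‖z‖ → 2 * ‖z‖ ≤ ‖f.eval z‖ := fun z hz =>
    hesc₀ z ((le_of_lt hR₀R).trans hz)
  have hN : ∀ᶠ N in atTop, ∀ c ∈ {c | f.derivative.eval c = 0}, R ≤ ‖(iter f N).eval c‖ := by
    rw [hfin.eventually_all]
    intro c hc
    have := hcrit c hc
    rw [isBounded_orbit_iff hRp hesc, trapped, mem_ofPred_eq] at this
    push Not at this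
    obtain ⟨m, hm⟩ := this
    filter_upwards [eventually_ge_atTop m] with N hN
    obtain ⟨k, rfl⟩ := Nat.exists_eq_add_of_le hN
    exact (le_mul_of_one_le_left hRp.le (one_le_pow₀ one_le_two)).trans
      (le_norm_iter_of_le hRp hesc hm k)
  obtain ⟨N, hN⟩ := hN.exists
  refine ⟨R, N, by lia, hRp, hesc, fun c hc j h => hR ?_, hN⟩
  exact mem_biUnion hc ⟨j, h⟩

namespace AdaptedRadius

variable {f : ℂ[X]} {R : ℝ} {N : ℕ}

theorem le_norm_iter (h : AdaptedRadius f R N) {z : ℂ} {m k : ℕ}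
    (hm : R ≤ ‖(iter f m).eval z‖) (hk : m ≤ k) : R ≤ ‖(iter f k).eval z‖ := by
  obtain ⟨j, rfl⟩ := Nat.exists_eq_add_of_le hk
  exact (le_mul_of_one_le_left h.pos.le (one_le_pow₀ one_le_two)).trans
    (le_norm_iter_of_le h.pos h.escape hm j)

theorem sublevel_anti (h : AdaptedRadius f R N) {m k : ℕ} (hk : m ≤ k) :
    sublevel (iter f k) R ⊆ sublevel (iter f m) R := fun z hz => by
  by_contra hz'
  exact not_lt.2 (h.le_norm_iter (not_lt.1 hz') hk) hz

theorem sublevel_add (f : ℂ[X]) (R : ℝ) (m n : ℕ) :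
    sublevel (iter f (m + n)) R = (iter f n).eval ⁻¹' sublevel (iter f m) R := by
  ext z
  rw [mem_preimage, mem_sublevel, mem_sublevel, eval_iter_add]

theorem derivative_ne_zero (h : AdaptedRadius f R N) {m : ℕ} {z : ℂ}
    (hz : ‖(iter f m).eval z‖ = R) : (iter f m).derivative.eval z ≠ 0 := by
  intro h0
  obtain ⟨k, hk, hc⟩ := exists_of_derivative_iter_eq_zero h0
  obtain ⟨j, rfl⟩ := Nat.exists_eq_add_of_le' hk.le
  exact h.norm_ne _ hc j (by rwa [← eval_iter_add])

theorem derivative_ne_zero_of_mem (h : AdaptedRadius f R N) {n : ℕ} {z : ℂ}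
    (hz : z ∈ sublevel (iter f (N + n)) R) : (iter f n).derivative.eval z ≠ 0 := by
  intro h0
  obtain ⟨k, hk, hc⟩ := exists_of_derivative_iter_eq_zero h0
  have h1 := h.crit_escape _ hc
  rw [← eval_iter_add] at h1
  exact not_lt.2 (h.le_norm_iter h1 (by lia : N + k ≤ N + n)) hz

theorem injOn (h : AdaptedRadius f R N) {n : ℕ} {x : ℂ} (hx : x ∈ sublevel (iter f (N + n)) R) :
    InjOn (iter f n).eval (connectedComponentIn (sublevel (iter f (N + n)) R) x) :=
  injOn_component_of_comp (iter_add f N n) (natDegree_iter_ne_zero h.natDegree_ne_zero _) h.pos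
    (fun _ hz => h.derivative_ne_zero hz) hx fun _ hu =>
      h.derivative_ne_zero_of_mem (connectedComponentIn_subset _ _ hu)

theorem image_component (h : AdaptedRadius f R N) {m n : ℕ} {x : ℂ}
    (hx : x ∈ sublevel (iter f (m + n)) R) :
    (iter f n).eval '' connectedComponentIn (sublevel (iter f (m + n)) R) x =
      connectedComponentIn (sublevel (iter f m) R) ((iter f n).eval x) := by
  rw [sublevel_add] at hx ⊢
  exact image_connectedComponentIn_preimage (natDegree_iter_ne_zero h.natDegree_ne_zero _)
    (isOpen_sublevel _ _) hx

theorem mem_trapped_iff_iter (h : AdaptedRadius f R N) (n : ℕ) (z : ℂ) :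
    (iter f n).eval z ∈ trapped f R ↔ z ∈ trapped f R := by
  constructor
  · intro hz m
    by_contra! hm
    have := h.le_norm_iter hm (Nat.le_add_right m n)
    rw [eval_iter_add] at this
    exact not_lt.2 this (hz m)
  · intro hz m
    rw [← eval_iter_add]
    exact hz _

theorem isCompact_trapped (h : AdaptedRadius f R N) : IsCompact (trapped f R) := by
  have : trapped f R = ⋂ m, {z | ‖(iter f m).eval z‖ ≤ R} := by
    ext z
    simp only [trapped, mem_ofPred_eq, mem_iInter]
    refine ⟨fun hz m => (hz m).le, fun hz m => ?_⟩
    by_contra! hm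
    have h1 := le_norm_iter_of_le h.pos h.escape hm 1
    have h2 := hz (m + 1)
    have h3 := h.pos
    linarith
  rw [this]
  exact (isCompact_norm_eval_le (natDegree_iter_ne_zero h.natDegree_ne_zero 0) R).of_isClosed_subset
    (isClosed_iInter fun m => isClosed_le (iter f m).continuous.norm continuous_const)
    (iInter_subset _ 0)

end AdaptedRadius

theorem uniform_zero_half_ball {g : ℕ → ℂ → ℂ} {w : ℂ} {ρ s M : ℝ} (hs : 0 < s) (hsρ : s ≤ ρ)
    (hg : ∀ n, DifferentiableOn ℂ (g n) (ball w ρ)) (hM : ∀ n, ∀ z ∈ ball w ρ, ‖g n z‖ ≤ M)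
    (h0 : ∀ ε > 0, ∀ᶠ n in atTop, ∀ z ∈ ball w s, ‖g n z‖ ≤ ε) :
    ∀ ε > 0, ∀ᶠ n in atTop, ∀ z ∈ ball w (ρ / 2), ‖g n z‖ ≤ ε := by
  have hρ : 0 < ρ := hs.trans_le hsρ
  have hM0 : 0 ≤ M := (norm_nonneg _).trans (hM 0 w (mem_ball_self hρ))
  have cauchy : ∀ n k t C, 0 < t → t < ρ → (∀ z ∈ sphere w t, ‖g n z‖ ≤ C) →
      ‖(k.factorial : ℂ)⁻¹ * iteratedDeriv k (g n) w‖ ≤ C / t ^ k := by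
    intro n k t C ht htρ hC
    have h := Complex.norm_iteratedDeriv_le_of_forall_mem_sphere_norm_le k ht
      ((hg n).diffContOnCl_ball (closedBall_subset_ball htρ)) hC
    have hk : (0 : ℝ) < k.factorial := by positivity
    rw [norm_mul, norm_inv, Complex.norm_natCast, inv_mul_le_iff₀ hk, ← mul_div_assoc]
    exact h
  have hbound : ∀ n k, ‖(k.factorial : ℂ)⁻¹ * iteratedDeriv k (g n) w‖ * (ρ / 2) ^ k ≤
      M * (2 / 3 : ℝ) ^ k := by
    intro n k
    have h := cauchy n k (3 * ρ / 4) M (by positivity) (by linarith) fun z hz =>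
      hM n z (sphere_subset_closedBall.trans (closedBall_subset_ball (by linarith)) hz)
    calc _ ≤ M / (3 * ρ / 4) ^ k * (ρ / 2) ^ k := by gcongr
      _ = M * ((ρ / 2) / (3 * ρ / 4)) ^ k := by
        rw [div_mul_eq_mul_div, mul_div_assoc, ← div_pow]
      _ = M * (2 / 3 : ℝ) ^ k := by
        congr 2
        field_simp
        norm_num
  have hsummable : Summable fun k : ℕ => M * (2 / 3 : ℝ) ^ k :=
    (summable_geometric_of_lt_one (by norm_num) (by norm_num)).mul_left M
  have hcoeff : ∀ k, Tendsto (fun n => ‖((k : ℕ).factorial : ℂ)⁻¹ * iteratedDeriv k (g n) w‖ *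
      (ρ / 2) ^ k) atTop (𝓝 0) := by
    intro k
    have : Tendsto (fun n => ‖((k : ℕ).factorial : ℂ)⁻¹ * iteratedDeriv k (g n) w‖)
        atTop (𝓝 0) := by
      rw [Metric.tendsto_nhds]
      intro ε hε
      filter_upwards [h0 (ε / 2 * (s / 2) ^ k) (by positivity)] with n hn
      have h := cauchy n k (s / 2) _ (by positivity) (by linarith) fun z hz =>
        hn z (sphere_subset_closedBall.trans (closedBall_subset_ball (by linarith)) hz)
      rw [mul_div_cancel_right₀ _ (by positivity)] at h
      rw [dist_zero_right, norm_norm]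
      linarith
    simpa using this.mul_const ((ρ / 2) ^ k)
  have hlim := tendsto_tsum_of_dominated_convergence hsummable hcoeff
    (Eventually.of_forall fun n k => by
      rw [Real.norm_of_nonneg (by positivity)]
      exact hbound n k)
  rw [tsum_zero] at hlim
  intro ε hε
  filter_upwards [hlim.eventually_le_const hε] with n hn z hz
  have hz' : z ∈ ball w ρ := ball_subset_ball (by linarith) hz
  have hT := Complex.hasSum_taylorSeries_on_ball (hg n) hz'
  refine le_trans ?_ hn
  rw [← hT.tsum_eq]
  refine tsum_of_norm_bounded (Summable.hasSum (hsummable.of_nonneg_of_le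
    (fun k => by positivity) (hbound n))) fun k => ?_
  rw [smul_eq_mul, smul_eq_mul, mul_left_comm, norm_mul, mul_comm, norm_pow]
  gcongr
  exact (mem_ball_iff_norm.1 hz).le

/-- A weak form of Vitali's convergence theorem. -/
theorem uniform_zero_of_isCompact {g : ℕ → ℂ → ℂ} {V K : Set ℂ} {q : ℂ} {r M : ℝ}
    (hV : IsOpen V) (hVc : IsPreconnected V) (hqV : q ∈ V) (hr : 0 < r)
    (hg : ∀ n, DifferentiableOn ℂ (g n) V) (hM : ∀ n, ∀ z ∈ V, ‖g n z‖ ≤ M)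
    (h0 : ∀ ε > 0, ∀ᶠ n in atTop, ∀ z ∈ ball q r, ‖g n z‖ ≤ ε) (hK : IsCompact K) (hKV : K ⊆ V) :
    ∀ ε > 0, ∀ᶠ n in atTop, ∀ z ∈ K, ‖g n z‖ ≤ ε := by
  set S : Set ℂ := {z | ∃ r > 0, ∀ ε > 0, ∀ᶠ n in atTop, ∀ w ∈ ball z r, ‖g n w‖ ≤ ε} with hS
  have hSo : IsOpen S := by
    rw [isOpen_iff_mem_nhds]
    rintro z ⟨r, hr, hz⟩
    filter_upwards [ball_mem_nhds z (half_pos hr)] with w hw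
    refine ⟨r / 2, half_pos hr, fun ε hε => ?_⟩
    filter_upwards [hz ε hε] with n hn u hu
    refine hn u (ball_subset_ball' ?_ hu)
    have := mem_ball.1 hw
    linarith
  have hVS : V ⊆ S := by
    refine hVc.subset_of_closure_inter_subset hSo ⟨q, hqV, r, hr, h0⟩ ?_
    rintro z ⟨hz, hzV⟩
    obtain ⟨ρ, hρ, hρV⟩ := Metric.isOpen_iff.1 hV z hzV
    obtain ⟨w, ⟨s, hs, hw⟩, hzw⟩ := Metric.mem_closure_iff.1 hz (ρ / 8) (by positivity)
    have hsub : ball w (ρ / 2) ⊆ V := (ball_subset_ball' (by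
      rw [dist_comm]
      linarith)).trans hρV
    have := uniform_zero_half_ball (w := w) (ρ := ρ / 2) (s := min s (ρ / 2))
      (lt_min hs (half_pos hρ)) (min_le_right _ _) (fun n => (hg n).mono hsub)
      (fun n z hz => hM n z (hsub hz)) fun ε hε => by
        filter_upwards [hw ε hε] with n hn z hz
        exact hn z (ball_subset_ball (min_le_left _ _) hz)
    refine ⟨ρ / 8, by positivity, fun ε hε => ?_⟩
    filter_upwards [this ε hε] with n hn u hu
    exact hn u (ball_subset_ball' (by linarith) hu)
  refine hK.induction_on (p := fun K => ∀ ε > 0, ∀ᶠ n in atTop, ∀ z ∈ K, ‖g n z‖ ≤ ε) ?_ ?_ ?_ ?_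
  · simp
  · intro s t hst ht ε hε
    filter_upwards [ht ε hε] with n hn z hz
    exact hn z (hst hz)
  · intro s t hs ht ε hε
    filter_upwards [hs ε hε, ht ε hε] with n hn hn' z hz
    exact hz.elim (hn z) (hn' z)
  · intro z hz
    obtain ⟨r, hr, h⟩ := hVS (hKV hz)
    exact ⟨ball z r, mem_nhdsWithin_of_mem_nhds (ball_mem_nhds z hr), h⟩

/-- A Landau-type covering theorem. -/
theorem exists_ball_subset_image {R M ε : ℝ} (hR : 0 < R) (hε : 0 < ε) :
    ∃ δ > 0, ∀ (g : ℂ → ℂ) (w : ℂ), DifferentiableOn ℂ g (ball w R) →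
      (∀ z ∈ ball w R, ‖g z‖ ≤ M) → ε ≤ ‖deriv g w‖ → ball (g w) δ ⊆ g '' ball w R := by
  by_cases hM0 : 0 ≤ M
  swap
  · exact ⟨1, one_pos, fun g w _ h _ => absurd ((norm_nonneg _).trans (h w (mem_ball_self hR))) hM0⟩
  set A : ℝ := (2 * M + R * ε) / R with hA
  have hεA : ε ≤ A := by
    rw [hA, le_div_iff₀ hR]
    linarith
  have hA0 : 0 < A := hε.trans_le hεA
  set t : ℝ := ε * R / (4 * A) with ht
  have ht0 : 0 < t := by positivity
  have htR : t < R := by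
    rw [ht, div_lt_iff₀ (by positivity)]
    nlinarith
  refine ⟨t * (ε / 2) / 2, by positivity, fun g w hg hgM hd => ?_⟩
  have hbound : ∀ z ∈ ball w R, ‖dslope g w z‖ ≤ A := fun z hz => by
    refine (Complex.norm_dslope_le_div_of_mapsTo_ball hg (R₂ := 2 * M) (fun u hu => ?_) hz).trans ?_
    · rw [mem_closedBall, dist_eq_norm]
      linarith [norm_sub_le (g u) (g w), hgM u hu, hgM w (mem_ball_self hR)]
    · rw [hA]
      gcongr
      nlinarith
  have hlow : ∀ z ∈ sphere w t, ε / 2 ≤ ‖dslope g w z‖ := fun z hz => by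
    have hzR : z ∈ ball w R := sphere_subset_closedBall.trans (closedBall_subset_ball htR) hz
    have h := Complex.dist_le_div_mul_dist_of_mapsTo_ball (R₂ := 2 * A)
      ((Complex.differentiableOn_dslope (ball_mem_nhds w hR)).2 hg) (fun u hu => by
        rw [mem_closedBall, dist_eq_norm]
        linarith [norm_sub_le (dslope g w u) (dslope g w w), hbound u hu,
          hbound w (mem_ball_self hR)]) hzR
    rw [mem_sphere.1 hz, dslope_same, dist_eq_norm, norm_sub_rev] at h
    have h2 : 2 * A / R * t = ε / 2 := by
      rw [ht]
      field_simp
      ring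
    linarith [norm_sub_norm_le (deriv g w) (dslope g w z)]
  have hne : deriv g w ≠ 0 := norm_pos_iff.1 (hε.trans_le hd)
  have hdiff : DifferentiableAt ℂ g w := hg.differentiableAt (ball_mem_nhds w hR)
  refine (DiffContOnCl.ball_subset_image_closedBall
    (hg.diffContOnCl_ball (closedBall_subset_ball htR)) ht0 (ε := t * (ε / 2)) (fun z hz => ?_)
    ?_).trans (image_mono (closedBall_subset_ball htR))
  · have h := sub_smul_dslope g w z
    rw [← h, norm_smul, ← dist_eq_norm, mem_sphere.1 hz]
    gcongr
    exact hlow z hz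
  · exact (hdiff.hasDerivAt.eventually_ne hne).frequently.filter_mono nhdsWithin_le_nhds

/-- Holomorphic maps of a disc into a bounded region with pairwise disjoint images become nearly
constant. -/
theorem uniform_zero_of_pairwise_disjoint {g : ℕ → ℂ → ℂ} {q : ℂ} {r M : ℝ} (hr : 0 < r)
    (hg : ∀ n, DifferentiableOn ℂ (g n) (ball q r)) (hM : ∀ n, ∀ z ∈ ball q r, ‖g n z‖ ≤ M)
    (hdisj : Pairwise fun m n => Disjoint (g m '' ball q r) (g n '' ball q r)) :
    ∀ ε > 0, ∀ᶠ n in atTop, ∀ z ∈ ball q (r / 2), ‖g n z - g n q‖ ≤ ε := by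
  intro ε hε
  obtain ⟨δ, hδ, hcover⟩ := exists_ball_subset_image (M := M) (half_pos hr) (div_pos hε hr)
  have hsub : ∀ w ∈ ball q (r / 2), ball w (r / 2) ⊆ ball q r := fun w hw =>
    ball_subset_ball' (by linarith [mem_ball.1 hw])
  have hfin : {n | ∃ w ∈ ball q (r / 2), ε / r ≤ ‖deriv (g n) w‖}.Finite := by
    by_contra hinf
    rw [← Set.Infinite] at hinf
    choose! w hw hwd using fun n (hn : n ∈ {n | ∃ w ∈ ball q (r / 2), ε / r ≤ ‖deriv (g n) w‖}) =>
      hn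
    obtain ⟨t, -, htf, ht⟩ := (isCompact_closedBall (0 : ℂ) M).finite_cover_balls (half_pos hδ)
    have hex : ∀ n, ∃ c, n ∈ {n | ∃ w ∈ ball q (r / 2), ε / r ≤ ‖deriv (g n) w‖} →
        c ∈ t ∧ dist (g n (w n)) c < δ / 2 := by
      intro n
      by_cases hn : n ∈ {n | ∃ w ∈ ball q (r / 2), ε / r ≤ ‖deriv (g n) w‖}
      · have := ht (mem_closedBall_zero_iff.2
          (hM n _ (hsub _ (hw n hn) (mem_ball_self (half_pos hr)))))
        simp only [mem_iUnion, mem_ball] at this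
        obtain ⟨c, hc, hc'⟩ := this
        exact ⟨c, fun _ => ⟨hc, hc'⟩⟩
      · exact ⟨0, fun h => absurd h hn⟩
    choose c hc using hex
    obtain ⟨m, hm, n, hn, hmn, hcmn⟩ := hinf.exists_ne_map_eq_of_mapsTo
      (fun n hn => (hc n hn).1) htf
    have himg : ∀ k ∈ {n | ∃ w ∈ ball q (r / 2), ε / r ≤ ‖deriv (g n) w‖},
        ball (g k (w k)) δ ⊆ g k '' ball q r := fun k hk =>
      (hcover (g k) (w k) ((hg k).mono (hsub _ (hw k hk)))
        (fun z hz => hM k z (hsub _ (hw k hk) hz))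
        (hwd k hk)).trans (image_mono (hsub _ (hw k hk)))
    refine Set.disjoint_left.1 (hdisj hmn) (himg m hm (mem_ball_self hδ)) (himg n hn ?_)
    rw [mem_ball]
    have h1 := (hc m hm).2
    have h2 := (hc n hn).2
    rw [hcmn] at h1
    linarith [dist_triangle_right (g m (w m)) (g n (w n)) (c n)]
  have := hfin.isBounded.bddAbove
  obtain ⟨B, hB⟩ := this
  filter_upwards [eventually_gt_atTop B] with n hn z hz
  have hder : ∀ w ∈ ball q (r / 2), ‖deriv (g n) w‖ ≤ ε / r := fun w hw => by
    by_contra! h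
    exact not_le.2 hn (hB ⟨w, hw, h.le⟩)
  have := (convex_ball q (r / 2)).norm_image_sub_le_of_norm_deriv_le (fun w hw =>
    (hg n).differentiableAt (isOpen_ball.mem_nhds (ball_subset_ball (by linarith) hw))) hder
    (mem_ball_self (half_pos hr)) hz
  refine this.trans ?_
  have hzq : ‖z - q‖ ≤ r := by linarith [mem_ball_iff_norm.1 hz]
  calc ε / r * ‖z - q‖ ≤ ε / r * r := by gcongr
    _ = ε := by field_simp

/-- A polynomial that maps an open set `U` injectively onto `V` without critical points has a
holomorphic inverse. -/
theorem exists_holomorphic_inverse {p : ℂ[X]} (hp : p.natDegree ≠ 0) {U V : Set ℂ} (hU : IsOpen U)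
    (hinj : InjOn p.eval U) (himg : p.eval '' U = V) (hd : ∀ u ∈ U, p.derivative.eval u ≠ 0) :
    ∃ g : ℂ → ℂ, DifferentiableOn ℂ g V ∧ (∀ v ∈ V, g v ∈ U ∧ p.eval (g v) = v) ∧
      ∀ u ∈ U, g (p.eval u) = u := by
  have hex : ∀ v, ∃ u, v ∈ V → u ∈ U ∧ p.eval u = v := fun v => by
    by_cases hv : v ∈ V
    · rw [← himg] at hv
      obtain ⟨u, hu, huv⟩ := hv
      exact ⟨u, fun _ => ⟨hu, huv⟩⟩
    · exact ⟨0, fun h => absurd h hv⟩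
  choose g hg using hex
  have hgl : ∀ u ∈ U, g (p.eval u) = u := fun u hu => by
    have h := hg (p.eval u) (himg ▸ mem_image_of_mem _ hu)
    exact hinj h.1 hu h.2
  have hopen := (p.isOpenQuotientMap_eval hp).isOpenMap
  have hV : IsOpen V := himg ▸ hopen U hU
  refine ⟨g, fun v hv => ?_, hg, hgl⟩
  have hcont : ContinuousAt g v := by
    intro W hW
    have hWU : W ∩ U ∈ 𝓝 (g v) := inter_mem hW (hU.mem_nhds (hg v hv).1)
    have := hopen.image_mem_nhds hWU
    rw [(hg v hv).2] at this
    rw [Filter.mem_map]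
    filter_upwards [this] with y hy
    obtain ⟨u, hu, rfl⟩ := hy
    rw [mem_preimage, hgl u hu.2]
    exact hu.1
  refine (HasDerivAt.of_local_left_inverse hcont (p.hasDerivAt (g v)) (hd _ (hg v hv).1)
    ?_).differentiableAt.differentiableWithinAt
  filter_upwards [hV.mem_nhds hv] with y hy
  exact (hg y hy).2

namespace AdaptedRadius

variable {f : ℂ[X]} {R : ℝ} {N : ℕ}

theorem exists_component_infinitely_often (h : AdaptedRadius f R N) {x : ℂ}
    (hx : x ∈ trapped f R) : ∃ z ∈ trapped f R, ∃ φ : ℕ → ℕ, StrictMono φ ∧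
      ∀ k, connectedComponentIn (sublevel (iter f N) R) ((iter f (φ k)).eval x) =
        connectedComponentIn (sublevel (iter f N) R) z := by
  obtain ⟨t, htK, ht⟩ := h.isCompact_trapped.elim_nhds_subcover
    (fun z => connectedComponentIn (sublevel (iter f N) R) z) fun z hz =>
      (isOpen_component _ _ z).mem_nhds (mem_connectedComponentIn (hz N))
  have hex : ∀ n, ∃ z : t, (iter f n).eval x ∈ connectedComponentIn (sublevel (iter f N) R) z := by
    intro n
    have := ht ((h.mem_trapped_iff_iter n x).2 hx)
    simp only [mem_iUnion] at this
    obtain ⟨z, hz, hz'⟩ := this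
    exact ⟨⟨z, hz⟩, hz'⟩
  choose c hc using hex
  obtain ⟨z, hz⟩ := Finite.exists_infinite_fiber c
  obtain ⟨φ, hφ, hφz⟩ := extraction_of_frequently_atTop
    (Nat.frequently_atTop_iff_infinite.2 (Set.infinite_coe_iff.1 hz))
  refine ⟨z, htK z z.2, φ, hφ, fun k => ?_⟩
  have h1 := hc (φ k)
  rw [show c (φ k) = z from hφz k] at h1
  exact (connectedComponentIn_eq h1).symm

/-- A component contains a ball whose points have escaped by a uniform time. -/
theorem exists_escaping_ball (h : AdaptedRadius f R N) {z : ℂ} (hz : z ∈ sublevel (iter f N) R) :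
    ∃ q r, 0 < r ∧ ball q r ⊆ connectedComponentIn (sublevel (iter f N) R) z ∧
      ∃ j, ∀ w ∈ ball q r, R ≤ ‖(iter f j).eval w‖ := by
  obtain ⟨b, hb, hbR⟩ := exists_norm_eval_eq_of_component
    (natDegree_iter_ne_zero h.natDegree_ne_zero N) hz
  have h1 : R < ‖(iter f (N + 1)).eval b‖ := by
    have := le_norm_iter_of_le h.pos h.escape hbR.ge 1
    have := h.pos
    linarith
  have h2 : IsOpen {w | R < ‖(iter f (N + 1)).eval w‖} :=
    isOpen_lt continuous_const (iter f (N + 1)).continuous.norm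
  obtain ⟨q, hq, hqV⟩ := mem_closure_iff.1 hb _ h2 h1
  obtain ⟨r, hr, hball⟩ := Metric.isOpen_iff.1 (h2.inter (isOpen_component _ _ z)) q ⟨hq, hqV⟩
  exact ⟨q, r, hr, fun w hw => (hball hw).2, N + 1, fun w hw => le_of_lt (hball hw).1⟩

theorem eq_of_mem_isPreconnected (h : AdaptedRadius f R N) {C : Set ℂ} (hC : IsPreconnected C)
    (hCK : C ⊆ trapped f R) {x y : ℂ} (hx : x ∈ C) (hy : y ∈ C) : x = y := by
  obtain ⟨z, hzK, φ, hφ, hφz⟩ := h.exists_component_infinitely_often (hCK hx)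
  obtain ⟨q, r, hr, hqV, j, hj⟩ := h.exists_escaping_ball (hzK N)
  set V := connectedComponentIn (sublevel (iter f N) R) z with hV
  have hVR : ∀ v ∈ V, ‖v‖ < R := fun v hv => by
    simpa [iter_zero, mem_sublevel] using
      h.sublevel_anti (Nat.zero_le N) (connectedComponentIn_subset _ _ hv)
  have hsub : ∀ n, connectedComponentIn (sublevel (iter f (N + n)) R) x ⊆
      sublevel (iter f (N + n)) R := fun n => connectedComponentIn_subset _ _
  set ψ : ℕ → ℕ := fun k => φ (k * (j + 1)) with hψ
  have hψz : ∀ k, (iter f (ψ k)).eval '' connectedComponentIn (sublevel (iter f (N + ψ k)) R) x =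
      V := fun k => by
    rw [h.image_component (hCK hx _)]
    exact hφz _
  choose g hgd hg hgl using fun k => exists_holomorphic_inverse
    (natDegree_iter_ne_zero h.natDegree_ne_zero (ψ k)) (isOpen_component _ _ x)
    (h.injOn (n := ψ k) (hCK hx _)) (hψz k)
    fun u hu => h.derivative_ne_zero_of_mem (hsub _ hu)
  have hgR : ∀ k, ∀ v ∈ V, ‖g k v‖ ≤ R := fun k v hv => by
    have := h.sublevel_anti (Nat.zero_le _) (hsub _ (hg k v hv).1)
    simpa [iter_zero] using (mem_sublevel.1 this).le
  have hdisj : Pairwise fun m n => Disjoint (g m '' ball q r) (g n '' ball q r) := by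
    have key : ∀ m n, m < n → Disjoint (g m '' ball q r) (g n '' ball q r) := by
      intro m n hmn
      rw [Set.disjoint_left]
      rintro _ ⟨a, ha, rfl⟩ ⟨b, hb, hab⟩
      have h1 := (hg m a (hqV ha)).2
      have h2 := (hg n b (hqV hb)).2
      have hle : ψ m + j ≤ ψ n := by
        have h3 := hφ.add_le_nat (j + 1) (m * (j + 1))
        have h4 : j + 1 + m * (j + 1) ≤ n * (j + 1) := by nlinarith
        have h5 := hφ.monotone h4
        simp only [hψ]
        lia
      obtain ⟨i, hi⟩ := Nat.exists_eq_add_of_le hle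
      rw [hab, show ψ n = (i + j) + ψ m by lia, eval_iter_add, h1] at h2
      have h3 := h.le_norm_iter (hj a ha) (by lia : j ≤ i + j)
      rw [h2] at h3
      exact not_lt.2 h3 (hVR b (hqV hb))
    intro m n hmn
    rcases hmn.lt_or_gt with h | h
    · exact key m n h
    · exact (key n m h).symm
  have hqV' : q ∈ V := hqV (mem_ball_self hr)
  have hunif := uniform_zero_of_pairwise_disjoint hr (fun n => (hgd n).mono hqV)
    (fun n v hv => hgR n v (hqV hv)) hdisj
  have hcompact : IsCompact (trapped f R ∩ V) := by
    have : trapped f R ∩ V = trapped f R ∩ closure V := by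
      refine Subset.antisymm (inter_subset_inter_right _ subset_closure) fun v hv => ⟨hv.1, ?_⟩
      exact mem_component_of_mem_closure (isOpen_sublevel _ _) hv.2 (hv.1 N)
    rw [this]
    exact h.isCompact_trapped.inter_right isClosed_closure
  have hlim := uniform_zero_of_isCompact (g := fun n v => g n v - g n q) (M := R + R)
    (isOpen_component _ _ z) isPreconnected_connectedComponentIn hqV' (half_pos hr)
    (fun n => (hgd n).sub_const _)
    (fun n v hv => (norm_sub_le _ _).trans (add_le_add (hgR n v hv) (hgR n q hqV'))) hunif
    hcompact inter_subset_right
  have hCU : ∀ n, C ⊆ connectedComponentIn (sublevel (iter f n) R) x := fun n =>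
    hC.subset_connectedComponentIn hx fun c hc => hCK hc n
  have hmem : ∀ n, ∀ c ∈ C, (iter f (ψ n)).eval c ∈ trapped f R ∩ V := fun n c hc =>
    ⟨(h.mem_trapped_iff_iter _ c).2 (hCK hc), hψz n ▸ mem_image_of_mem _ (hCU _ hc)⟩
  by_contra hxy
  have hpos : 0 < ‖x - y‖ := norm_pos_iff.2 (sub_ne_zero.2 hxy)
  obtain ⟨n, hn⟩ := (hlim (‖x - y‖ / 3) (by positivity)).exists
  have h1 := hn _ (hmem n x hx)
  have h2 := hn _ (hmem n y hy)
  rw [hgl n x (hCU _ hx)] at h1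
  rw [hgl n y (hCU _ hy)] at h2
  have h3 := norm_sub_le (x - g n q) (y - g n q)
  rw [sub_sub_sub_cancel_right] at h3
  linarith

end AdaptedRadius

theorem exists_derivative_eval_eq_zero_of_fiber_subset {f : ℂ[X]} (hf : 2 ≤ f.natDegree) {z : ℂ}
    (h : ∀ w, f.eval w = z → w = z) : f.derivative.eval z = 0 := by
  have hd : (f - C z).natDegree = f.natDegree := natDegree_sub_C
  have h0 : f - C z ≠ 0 := fun h0 => by
    rw [h0, natDegree_zero] at hd
    lia
  have hrep : (f - C z).roots = Multiset.replicate (Multiset.card (f - C z).roots) z :=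
    Multiset.eq_replicate_card.2 fun w hw => h w (by
      have := (mem_roots'.1 hw).2
      rwa [IsRoot.def, eval_sub, eval_C, sub_eq_zero] at this)
  have hcard : Multiset.card (f - C z).roots = f.natDegree := by
    rw [← hd]
    exact ((IsAlgClosed.splits (f - C z)).natDegree_eq_card_roots).symm
  have hmult : 1 < (f - C z).rootMultiplicity z := by
    rw [← count_roots, hrep, Multiset.count_replicate_self, hcard]
    lia
  have := ((one_lt_rootMultiplicity_iff_isRoot h0).1 hmult).2
  simpa using this

namespace AdaptedRadius

variable {f : ℂ[X]} {R : ℝ} {N : ℕ}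

theorem isTotallyDisconnected_trapped (h : AdaptedRadius f R N) :
    IsTotallyDisconnected (trapped f R) := fun _ hC hCp _ hx _ hy =>
  h.eq_of_mem_isPreconnected hCp hC hx hy

theorem frontier_trapped (h : AdaptedRadius f R N) : frontier (trapped f R) = trapped f R := by
  rw [h.isCompact_trapped.isClosed.frontier_eq, sdiff_eq_left, Set.disjoint_right]
  intro z hz
  obtain ⟨r, hr, hball⟩ := Metric.mem_nhds_iff.1 (mem_interior_iff_mem_nhds.1 hz)
  have hw : z + (r / 2 : ℝ) ∈ ball z r := by
    rw [mem_ball_iff_norm, add_sub_cancel_left, Complex.norm_real,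
      Real.norm_of_nonneg (by positivity)]
    linarith
  have := h.eq_of_mem_isPreconnected (convex_ball z r).isPreconnected hball
    (mem_ball_self hr) hw
  rw [left_eq_add, Complex.ofReal_eq_zero] at this
  linarith

theorem exists_escape_time_of_isCompact (h : AdaptedRadius f R N) {S : Set ℂ} (hS : IsCompact S)
    (hSK : Disjoint S (trapped f R)) : ∃ m, ∀ w ∈ S, R ≤ ‖(iter f m).eval w‖ := by
  refine hS.induction_on (p := fun S => ∃ m, ∀ w ∈ S, R ≤ ‖(iter f m).eval w‖) ?_ ?_ ?_ ?_
  · simp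
  · rintro s t hst ⟨m, hm⟩
    exact ⟨m, fun w hw => hm w (hst hw)⟩
  · rintro s t ⟨m, hm⟩ ⟨n, hn⟩
    refine ⟨max m n, fun w hw => ?_⟩
    rcases hw with hw | hw
    · exact h.le_norm_iter (hm w hw) (le_max_left _ _)
    · exact h.le_norm_iter (hn w hw) (le_max_right _ _)
  · intro w hw
    have := Set.disjoint_left.1 hSK hw
    rw [trapped, mem_ofPred_eq] at this
    push Not at this
    obtain ⟨m, hm⟩ := this
    have h1 := le_norm_iter_of_le h.pos h.escape hm 1
    have h2 : R < ‖(iter f (m + 1)).eval w‖ := by linarith [h.pos]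
    refine ⟨{w | R < ‖(iter f (m + 1)).eval w‖}, mem_nhdsWithin_of_mem_nhds
      ((isOpen_lt continuous_const (iter f (m + 1)).continuous.norm).mem_nhds h2),
      m + 1, fun w hw => le_of_lt hw⟩

theorem trapped_subset_of_isolated (h : AdaptedRadius f R N) {z : ℂ} (hz : z ∈ trapped f R)
    {W : Set ℂ} (hW : W ∈ 𝓝 z) (hiso : ∀ y ∈ W ∩ trapped f R, y = z) : trapped f R ⊆ {z} := by
  obtain ⟨r, hr, hrW⟩ := Metric.nhds_basis_closedBall.mem_iff.1 hW
  obtain ⟨m, hm⟩ := h.exists_escape_time_of_isCompact (isCompact_sphere z r) (by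
    rw [Set.disjoint_left]
    intro w hw hwK
    rw [hiso w ⟨hrW (sphere_subset_closedBall hw), hwK⟩, mem_sphere, dist_self] at hw
    exact hr.ne hw)
  have hUW : connectedComponentIn (sublevel (iter f (0 + m)) R) z ⊆ ball z r := by
    refine isPreconnected_connectedComponentIn.subset_of_closure_inter_subset isOpen_ball
      ⟨z, mem_connectedComponentIn (hz _), mem_ball_self hr⟩ ?_
    rintro w ⟨hw, hwU⟩
    have hwm := connectedComponentIn_subset _ _ hwU
    rw [zero_add, mem_sublevel] at hwm
    rw [mem_ball]
    refine lt_of_le_of_ne (mem_closedBall.1 (closure_ball_subset_closedBall hw)) fun hwr => ?_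
    exact not_lt.2 (hm w hwr) hwm
  have himg := h.image_component (m := 0) (n := m) (hz _)
  have hball : sublevel (iter f 0) R = ball 0 R := by
    ext w
    simp [mem_sublevel, iter_zero]
  have hsub : trapped f R ⊆ {(iter f m).eval z} := by
    intro k hk
    have : k ∈ (iter f m).eval '' connectedComponentIn (sublevel (iter f (0 + m)) R) z := by
      rw [himg, hball]
      refine (convex_ball 0 R).isPreconnected.subset_connectedComponentIn ?_ Subset.rfl ?_
      · rw [← hball]
        exact ((h.mem_trapped_iff_iter m z).2 hz) 0
      · rw [← hball]
        exact hk 0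
    obtain ⟨u, hu, rfl⟩ := this
    rw [mem_singleton_iff, hiso u ⟨hrW (ball_subset_closedBall (hUW hu)),
      (h.mem_trapped_iff_iter m u).1 hk⟩]
  intro k hk
  rw [mem_singleton_iff, hsub hk, ← hsub hz]

theorem preperfect_trapped (h : AdaptedRadius f R N) (hf : 2 ≤ f.natDegree) :
    Preperfect (trapped f R) := by
  intro z hz
  rw [accPt_iff_nhds]
  by_contra! hacc
  obtain ⟨W, hW, hiso⟩ := hacc
  have hsub := h.trapped_subset_of_isolated hz hW hiso
  have hcrit : f.derivative.eval z = 0 :=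
    exists_derivative_eval_eq_zero_of_fiber_subset hf fun w hw =>
      hsub ((h.mem_trapped_iff_iter 1 w).1 (by
        rw [← zero_add 1, eval_iter_succ, iter_zero, eval_X, hw]
        exact hz))
  exact not_lt.2 (h.crit_escape z hcrit) (hz N)

end AdaptedRadius

theorem exists_eval_eq_self {f : ℂ[X]} (hf : 2 ≤ f.natDegree) : ∃ z, f.eval z = z := by
  have hd : (f - X).natDegree = f.natDegree :=
    natDegree_sub_eq_left_of_natDegree_lt (by rw [natDegree_X]; lia)
  obtain ⟨z, hz⟩ := IsAlgClosed.exists_root (f - X)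
    (natDegree_pos_iff_degree_pos.1 (by rw [hd]; lia)).ne'
  exact ⟨z, by simpa [sub_eq_zero] using hz⟩

end

/-- **Fatou–Julia.** If no critical point of a complex polynomial of degree `≥ 2` lies in
the filled-in Julia set, then the Julia set is a Cantor set. -/
theorem julia_cantor_of_no_bounded_critical_point
    (f : Polynomial ℂ) (d : ℕ) (hd : 2 ≤ d) (hdeg : f.natDegree = d)
    (Kf : Set ℂ)
    (hKf : Kf = {z : ℂ | Bornology.IsBounded
      (Set.range fun n : ℕ => (fun w : ℂ => f.eval w)^[n] z)})
    (Jf : Set ℂ) (hJf : Jf = frontier Kf)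
    (hcrit : ∀ c : ℂ, f.derivative.eval c = 0 → c ∉ Kf) :
    Jf.Nonempty ∧ IsCompact Jf ∧ Perfect Jf ∧ IsTotallyDisconnected Jf := by
  subst hJf hKf
  obtain ⟨R, N, h⟩ := exists_adaptedRadius (f := f) (by lia) hcrit
  obtain ⟨z, hz⟩ := exists_eval_eq_self (f := f) (by lia)
  have hK : {z : ℂ | Bornology.IsBounded
      (Set.range fun n : ℕ => (fun w : ℂ => f.eval w)^[n] z)} = trapped f R :=
    Set.ext fun z => isBounded_orbit_iff h.pos h.escape z
  rw [hK, h.frontier_trapped]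
  refine ⟨⟨z, (isBounded_orbit_iff h.pos h.escape z).1 ?_⟩, h.isCompact_trapped,
    ⟨h.isCompact_trapped.isClosed, h.preperfect_trapped (by lia)⟩,
    h.isTotallyDisconnected_trapped⟩
  refine (Set.finite_singleton z).isBounded.subset (Set.range_subset_iff.2 fun n => ?_)
  exact Function.iterate_fixed (f := fun w : ℂ => f.eval w) hz n
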